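/- Let L ⊆ ℂ be a compact set with connected complement whose connected components are K₀, K₁, …, K_m (m ≥ 1), where K₀ has nonempty interior and each K_i with 1 ≤ i ≤ m contains more than one point. For any function G : L → ℂ such that for each i ∈ {0,…,m} the restriction of G to K_i equals a complex polynomial q_i, with q_i ≠ q_j whenever i ≠ j, set d_n(G) := inf{ sup_{z∈L}|G(z) − p(z)| : p a complex polynomial of degree at most n } for n ≥ 1. Then the number limsup_{n→∞} d_n(G)^{1/n} lies in the open interval (0,1) and is the same for every such function G (it depends only on L). -/

import Mathlib

open Filter Topology Metric

/-- The `n`-th partial sum of the Taylor series of `f` at `z₀`: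
`S_n(f,z₀)(z) = Σ_{k=0}^{n} (f^{(k)}(z₀)/k!)·(z−z₀)^k`. -/
noncomputable def taylorSum (f : ℂ → ℂ) (z₀ : ℂ) (n : ℕ) (z : ℂ) : ℂ :=
  ∑ k ∈ Finset.range (n + 1), (iteratedDeriv k f z₀ / (Nat.factorial k)) * (z - z₀) ^ k

/-- Supremum norm of `g` on `X`. -/
noncomputable def supNorm (g : ℂ → ℂ) (X : Set ℂ) : ℝ :=
  sSup ((fun z => ‖g z‖) '' X)

/-- Membership in `A(X)`: continuous on `X` and holomorphic on the interior of `X`. -/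
def memA (X : Set ℂ) (f : ℂ → ℂ) : Prop :=
  ContinuousOn f X ∧ DifferentiableOn ℂ f (interior X)

/-- Best sup-norm approximation error of `G` on `L` by polynomials of degree at most `n`. -/
noncomputable def dApprox (L : Set ℂ) (G : ℂ → ℂ) (n : ℕ) : ℝ :=
  sInf {c : ℝ | ∃ p : Polynomial ℂ, p.degree ≤ (n : ℕ) ∧
    c = supNorm (fun z => G z - Polynomial.eval z p) L}

/-- The asymptotic quantity `limsup_n d_n(G)^{1/n}`; for a function `G` which is equal to a
different polynomial on each connected component of `L` this is the asymptotic convergence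
factor `ρ_L` of `L`. -/
noncomputable def rho (L : Set ℂ) (G : ℂ → ℂ) : ℝ :=
  Filter.limsup (fun n : ℕ => dApprox L G n ^ (1 / (n : ℝ))) Filter.atTop

/-- Evaluation form of Lagrange interpolation. -/
theorem lagr_eval {F : Type*} [Field F] {n : ℕ} (v : ℕ → F)
    (hv : Set.InjOn v (Finset.range (n + 1))) (Q : Polynomial F) (hQ : Q.natDegree ≤ n) (x : F) :
    Q.eval x = ∑ i ∈ Finset.range (n + 1), Q.eval (v i) *
      ∏ j ∈ (Finset.range (n + 1)).erase i, ((v i - v j)⁻¹ * (x - v j)) := by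
  have hd : Q.degree < (Finset.range (n + 1)).card := by
    rw [Finset.card_range]
    exact lt_of_le_of_lt (Polynomial.degree_le_of_natDegree_le hQ) (by exact_mod_cast Nat.lt_succ_self n)
  conv_lhs => rw [Lagrange.eq_interpolate hv hd, Lagrange.interpolate_apply,
    Polynomial.eval_finsetSum]
  refine Finset.sum_congr rfl fun i _ => ?_
  rw [Polynomial.eval_mul, Polynomial.eval_C, Lagrange.basis, Polynomial.eval_prod]
  congr 1
  refine Finset.prod_congr rfl fun j _ => ?_
  simp [Lagrange.basisDivisor]

open Polynomial.Chebyshev in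
theorem cheb_sum (n : ℕ) (x : ℝ) (hx : 1 ≤ x) :
    ∑ i ∈ Finset.range (n + 1), ∏ j ∈ (Finset.range (n + 1)).erase i,
      (|node n i - node n j|⁻¹ * (x - node n j)) ≤ Real.exp (Real.arcosh x) ^ n := by
  have h1 := lagr_eval (n := n) (node n) (strictAntiOn_node n).injOn (T ℝ n) (by simp) x
  have h2 : (T ℝ n).eval x ≤ Real.exp (Real.arcosh x) ^ n := by
    conv_lhs => rw [← Real.cosh_arcosh hx]
    rw [T_real_cosh, ← Real.exp_nat_mul, Real.cosh_eq]
    have h3 : 0 ≤ (n:ℝ) * Real.arcosh x := mul_nonneg (by positivity) (Real.arcosh_nonneg hx)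
    have h4 : Real.exp (-((n:ℝ) * Real.arcosh x)) ≤ Real.exp ((n:ℝ) * Real.arcosh x) :=
      Real.exp_le_exp.2 (by linarith)
    push_cast
    linarith
  refine le_trans (le_of_eq ?_) h2
  rw [h1]
  refine Finset.sum_congr rfl fun i hi => ?_
  have hi' : i ≤ n := by simpa [Nat.lt_succ_iff] using hi
  rw [eval_T_real_node (by simpa using hi'), Finset.prod_mul_distrib, Finset.prod_mul_distrib,
    Finset.prod_inv_distrib, Finset.prod_inv_distrib, ← Finset.abs_prod]
  have h5 := zero_lt_prod_node_sub_node hi'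
  have h6 : |∏ j ∈ (Finset.range (n + 1)).erase i, (node n i - node n j)| =
      (-1) ^ i * ∏ j ∈ (Finset.range (n + 1)).erase i, (node n i - node n j) := by
    rw [← abs_of_pos h5, abs_mul]; simp
  rw [h6, mul_inv, ← inv_pow, inv_neg_one, mul_assoc]

/-- Bernstein–Walsh type inequality for connected sets. -/
theorem bernstein_walsh (K : Set ℂ) (hK : IsPreconnected K) (a b : ℂ) (ha : a ∈ K) (hb : b ∈ K)
    (hab : a ≠ b) (n : ℕ) (Q : Polynomial ℂ) (hQ : Q.natDegree ≤ n) (M : ℝ)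
    (hM : ∀ z ∈ K, ‖Q.eval z‖ ≤ M) (z : ℂ) :
    ‖Q.eval z‖ ≤ M * Real.exp (Real.arcosh (1 + 2 * ‖z - a‖ / ‖b - a‖)) ^ n := by
  set R := ‖b - a‖ with hR
  have hR0 : 0 < R := norm_pos_iff.2 (sub_ne_zero.2 hab.symm)
  set x := 1 + 2 * ‖z - a‖ / R with hx
  have hx1 : 1 ≤ x := by rw [hx]; have : 0 ≤ 2 * ‖z - a‖ / R := by positivity
                         linarith
  have hM0 : 0 ≤ M := (norm_nonneg _).trans (hM a ha)
  have hiv := hK.intermediate_value (f := fun w => ‖w - a‖) ha hb (by fun_prop)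
  simp only [sub_self, norm_zero] at hiv
  have hex : ∀ i : ℕ, ∃ w ∈ K, ‖w - a‖ = R * (1 - Polynomial.Chebyshev.node n i) / 2 := by
    intro i
    have := Polynomial.Chebyshev.node_mem_Icc (n := n) (i := i)
    have h := hiv (a := R * (1 - Polynomial.Chebyshev.node n i) / 2)
      ⟨by nlinarith [this.1, this.2], by nlinarith [this.1, this.2]⟩
    obtain ⟨w, hw, hw2⟩ := h
    exact ⟨w, hw, hw2⟩
  choose v hvK hv using hex
  have hdist : ∀ i j, R / 2 * |Polynomial.Chebyshev.node n i - Polynomial.Chebyshev.node n j| ≤ ‖v i - v j‖ := by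
    intro i j
    have h := abs_norm_sub_norm_le (v i - a) (v j - a)
    rw [hv, hv, sub_sub_sub_cancel_right] at h
    refine le_trans (le_of_eq ?_) h
    rw [show R * (1 - Polynomial.Chebyshev.node n i) / 2 - R * (1 - Polynomial.Chebyshev.node n j) / 2
      = -((R/2) * (Polynomial.Chebyshev.node n i - Polynomial.Chebyshev.node n j)) by ring, abs_neg, abs_mul,
      abs_of_pos (by positivity : 0 < R/2)]
  have hne : ∀ i ≤ n, ∀ j ≤ n, i ≠ j → 0 < |Polynomial.Chebyshev.node n i - Polynomial.Chebyshev.node n j| := by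
    intro i hi j hj hij
    rw [abs_pos, sub_ne_zero]
    intro h
    exact hij ((Polynomial.Chebyshev.strictAntiOn_node n).injOn (by simp; omega) (by simp; omega) h)
  have hinj : Set.InjOn v (Finset.range (n + 1)) := by
    intro i hi j hj hij
    by_contra hne'
    have h1 := hdist i j
    rw [hij, sub_self, norm_zero] at h1
    have h2 := hne i (by simp at hi; omega) j (by simp at hj; omega) hne'
    nlinarith [mul_pos (half_pos hR0) h2]
  rw [lagr_eval v hinj Q hQ z]
  refine (norm_sum_le _ _).trans ?_
  refine le_trans ?_ (mul_le_mul_of_nonneg_left (cheb_sum n x hx1) hM0)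
  rw [Finset.mul_sum]
  refine Finset.sum_le_sum fun i hi => ?_
  rw [norm_mul, norm_prod]
  refine mul_le_mul (hM _ (hvK i)) ?_ (by positivity) hM0
  refine Finset.prod_le_prod (fun _ _ => norm_nonneg _) fun j hj => ?_
  rw [Finset.mem_erase] at hj
  have hi' : i ≤ n := by simpa [Nat.lt_succ_iff] using hi
  have hj' : j ≤ n := by simpa [Nat.lt_succ_iff] using hj.2
  have h1 := hne i hi' j hj' (Ne.symm hj.1)
  have h2 := hdist i j
  rw [norm_mul, norm_inv]
  have h3 : ‖z - v j‖ ≤ R / 2 * (x - Polynomial.Chebyshev.node n j) := by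
    have : ‖z - v j‖ ≤ ‖z - a‖ + ‖v j - a‖ := by
      rw [← sub_sub_sub_cancel_right z (v j) a]; exact norm_sub_le _ _
    rw [hv] at this
    refine this.trans (le_of_eq ?_)
    rw [hx]; field_simp; ring
  calc ‖v i - v j‖⁻¹ * ‖z - v j‖ ≤ (R / 2 * |Polynomial.Chebyshev.node n i - Polynomial.Chebyshev.node n j|)⁻¹ *
        (R / 2 * (x - Polynomial.Chebyshev.node n j)) := by
        gcongr
    _ = _ := by field_simp

/-- Regularity of nontrivial continua. -/
theorem regular_continuum (K : Set ℂ) (hK : IsPreconnected K) (hnt : K.Nontrivial) (a : ℂ) (ha : a ∈ K)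
    (η : ℝ) (hη : 1 < η) : ∃ δ > 0, ∀ (n : ℕ) (Q : Polynomial ℂ) (M : ℝ), Q.natDegree ≤ n →
      (∀ z ∈ K, ‖Q.eval z‖ ≤ M) → ∀ z, ‖z - a‖ ≤ δ → ‖Q.eval z‖ ≤ M * η ^ n := by
  obtain ⟨b, hb, hba⟩ := hnt.exists_ne a
  have hR0 : 0 < ‖b - a‖ := norm_pos_iff.2 (sub_ne_zero.2 hba)
  have hc : ContinuousWithinAt (fun x => Real.exp (Real.arcosh x)) (Set.Ici 1) 1 :=
    (Real.continuous_exp.comp_continuousOn Real.continuousOn_arcosh) 1 Set.self_mem_Ici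
  have h1 : ∀ᶠ x in 𝓝[≥] (1:ℝ), Real.exp (Real.arcosh x) < η :=
    hc.eventually (gt_mem_nhds (by simpa using hη))
  obtain ⟨ε, hε, h2⟩ := Metric.mem_nhdsWithin_iff.1 h1
  refine ⟨‖b - a‖ * ε / 4, by positivity, fun n Q M hQ hM z hz => ?_⟩
  have h3 := bernstein_walsh K hK a b ha hb hba.symm n Q hQ M hM z
  have hM0 : 0 ≤ M := (norm_nonneg _).trans (hM a ha)
  refine h3.trans ?_
  have h4 : 0 ≤ 2 * ‖z - a‖ / ‖b - a‖ := by positivity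
  have h5 : 2 * ‖z - a‖ / ‖b - a‖ < ε := by
    rw [div_lt_iff₀ hR0]; nlinarith [mul_pos hR0 hε]
  have h6 : Real.exp (Real.arcosh (1 + 2 * ‖z - a‖ / ‖b - a‖)) < η := by
    refine h2 ⟨?_, ?_⟩
    · rw [Metric.mem_ball, Real.dist_eq, add_sub_cancel_left, abs_of_nonneg h4]; exact h5
    · simp only [Set.mem_Ici]; linarith
  gcongr

/-- Locally uniform bound on all of the plane. -/
theorem bernstein_walsh_ball (K : Set ℂ) (hK : IsPreconnected K) (hnt : K.Nontrivial) (ρ : ℝ) :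
    ∃ B : ℝ, 1 ≤ B ∧ ∀ (n : ℕ) (Q : Polynomial ℂ) (M : ℝ), Q.natDegree ≤ n →
      (∀ z ∈ K, ‖Q.eval z‖ ≤ M) → ∀ z, ‖z‖ ≤ ρ → ‖Q.eval z‖ ≤ M * B ^ n := by
  obtain ⟨a, ha, b, hb, hab⟩ := hnt
  have hR0 : 0 < ‖b - a‖ := norm_pos_iff.2 (sub_ne_zero.2 hab.symm)
  have h0 : 0 ≤ 2 * (|ρ| + ‖a‖) / ‖b - a‖ := by positivity
  refine ⟨Real.exp (Real.arcosh (1 + 2 * (|ρ| + ‖a‖) / ‖b - a‖)), ?_, fun n Q M hQ hM z hz => ?_⟩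
  · exact Real.one_le_exp (Real.arcosh_nonneg (by linarith))
  have h3 := bernstein_walsh K hK a b ha hb hab n Q hQ M hM z
  have hM0 : 0 ≤ M := (norm_nonneg _).trans (hM a ha)
  refine h3.trans ?_
  have h4 : 0 ≤ 2 * ‖z - a‖ / ‖b - a‖ := by positivity
  have h5 : ‖z - a‖ ≤ |ρ| + ‖a‖ := (norm_sub_le _ _).trans (by gcongr; exact hz.trans (le_abs_self ρ))
  have h6 : Real.arcosh (1 + 2 * ‖z - a‖ / ‖b - a‖) ≤ Real.arcosh (1 + 2 * (|ρ| + ‖a‖) / ‖b - a‖) := by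
    rw [Real.arcosh_le_arcosh (by linarith) (by linarith)]
    gcongr
  gcongr

/-- `f` is on `L` the sum of a series of polynomials `δ j` with `deg δ j ≤ j` and geometric decay. -/
def Apx (L : Set ℂ) (r : ℝ) (f : ℂ → ℂ) : Prop :=
  ∃ (δ : ℕ → Polynomial ℂ) (C : ℝ), (∀ j, (δ j).natDegree ≤ j) ∧
    (∀ j, ∀ z ∈ L, ‖(δ j).eval z‖ ≤ C * r ^ j) ∧
    (∀ z ∈ L, HasSum (fun j => (δ j).eval z) (f z))

/-- `f` is approximable at geometric rate `r`. -/
def Apn (L : Set ℂ) (r : ℝ) (f : ℂ → ℂ) : Prop :=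
  ∃ C : ℝ, ∀ n : ℕ, ∃ p : Polynomial ℂ, p.natDegree ≤ n ∧ ∀ z ∈ L, ‖f z - p.eval z‖ ≤ C * r ^ n

theorem apx_of_apn {L : Set ℂ} {r : ℝ} {f : ℂ → ℂ} (h0 : 0 < r) (h1 : r < 1) (h : Apn L r f) :
    Apx L r f := by
  obtain ⟨C, hC⟩ := h
  choose p hp hpC using hC
  refine ⟨fun j => Nat.casesOn j (p 0) (fun k => p (k+1) - p k),
    ‖(p 0).coeff 0‖ + |C| * (1 + 1 / r), ?_, ?_, ?_⟩
  · intro j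
    cases j with
    | zero => exact hp 0
    | succ k =>
      refine (Polynomial.natDegree_sub_le _ _).trans (max_le (hp _) ((hp k).trans (by omega)))
  · intro j z hz
    cases j with
    | zero =>
      have : p 0 = Polynomial.C ((p 0).coeff 0) := Polynomial.eq_C_of_natDegree_le_zero (hp 0)
      simp only [pow_zero, mul_one]
      rw [this]; simp
      positivity
    | succ k =>
      simp only [Polynomial.eval_sub]
      have e1 := hpC (k+1) z hz
      have e2 := hpC k z hz
      have e3 : ‖(p (k+1)).eval z - (p k).eval z‖ ≤ C * r ^ (k+1) + C * r ^ k := by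
        rw [show (p (k+1)).eval z - (p k).eval z = (f z - (p k).eval z) - (f z - (p (k+1)).eval z) by ring]
        exact (norm_sub_le _ _).trans (by linarith)
      refine e3.trans ?_
      have e4 : C * r ^ (k+1) + C * r ^ k = C * (1 + 1/r) * r ^ (k+1) := by
        field_simp
        ring
      rw [e4]
      have : C ≤ |C| := le_abs_self C
      have : 0 ≤ ‖(p 0).coeff 0‖ := norm_nonneg _
      gcongr
      have : C * (1 + 1/r) ≤ |C| * (1 + 1/r) := by gcongr
      linarith
  · intro z hz
    have hb : ∀ j : ℕ, ‖(Polynomial.eval z (Nat.casesOn (motive := fun _ => Polynomial ℂ) j (p 0)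
        (fun k => p (k+1) - p k)))‖ ≤ (‖(p 0).eval z‖ + |C| * (1 + 1 / r)) * r ^ j := by
      intro j
      cases j with
      | zero => simp; positivity
      | succ k =>
        simp only [Polynomial.eval_sub]
        have e1 := hpC (k+1) z hz
        have e2 := hpC k z hz
        have e3 : ‖(p (k+1)).eval z - (p k).eval z‖ ≤ C * r ^ (k+1) + C * r ^ k := by
          rw [show (p (k+1)).eval z - (p k).eval z = (f z - (p k).eval z) - (f z - (p (k+1)).eval z) by ring]
          exact (norm_sub_le _ _).trans (by linarith)
        refine e3.trans ?_
        have e4 : C * r ^ (k+1) + C * r ^ k = C * (1 + 1/r) * r ^ (k+1) := by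
          field_simp
          ring
        rw [e4]
        have : C ≤ |C| := le_abs_self C
        have : 0 ≤ ‖(p 0).eval z‖ := norm_nonneg _
        gcongr
        have : C * (1 + 1/r) ≤ |C| * (1 + 1/r) := by gcongr
        linarith
    have hs : Summable (fun j : ℕ => Polynomial.eval z (Nat.casesOn (motive := fun _ => Polynomial ℂ) j (p 0)
        (fun k => p (k+1) - p k))) :=
      Summable.of_norm_bounded ((summable_geometric_of_lt_one h0.le h1).mul_left _) hb
    rw [hs.hasSum_iff_tendsto_nat, ← tendsto_add_atTop_iff_nat 1]
    have hsum : ∀ n : ℕ, ∑ i ∈ Finset.range (n+1), Polynomial.eval z (Nat.casesOn (motive := fun _ => Polynomial ℂ) i (p 0)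
        (fun k => p (k+1) - p k)) = (p n).eval z := by
      intro n
      induction n with
      | zero => simp
      | succ k ih => rw [Finset.sum_range_succ, ih]; simp
    simp only [hsum]
    rw [tendsto_iff_norm_sub_tendsto_zero]
    have ht : Tendsto (fun n : ℕ => C * r ^ n) atTop (𝓝 0) := by
      simpa using (tendsto_pow_atTop_nhds_zero_of_lt_one h0.le h1).const_mul C
    refine squeeze_zero (fun _ => norm_nonneg _) (fun n => ?_) ht
    rw [norm_sub_rev]; exact hpC n z hz

theorem natDegree_sum_range_le (δ : ℕ → Polynomial ℂ) (hδ : ∀ j, (δ j).natDegree ≤ j) (n : ℕ) :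
    (∑ j ∈ Finset.range (n + 1), δ j).natDegree ≤ n :=
  Polynomial.natDegree_sum_le_of_forall_le _ _ fun j hj =>
    (hδ j).trans (by simpa [Nat.lt_succ_iff] using hj)

theorem apn_of_apx {L : Set ℂ} {r : ℝ} {f : ℂ → ℂ} (h0 : 0 < r) (h1 : r < 1) (h : Apx L r f) :
    Apn L r f := by
  obtain ⟨δ, C, hδ, hC, hs⟩ := h
  refine ⟨C * r / (1 - r), fun n => ⟨∑ j ∈ Finset.range (n + 1), δ j,
    natDegree_sum_range_le δ hδ n, fun z hz => ?_⟩⟩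
  have := norm_sub_le_of_geometric_bound_of_hasSum h1 (fun j => hC j z hz) (hs z hz) (n + 1)
  rw [norm_sub_rev, Polynomial.eval_finsetSum]
  refine this.trans (le_of_eq ?_)
  ring

theorem apn_congr {L : Set ℂ} {r : ℝ} {f g : ℂ → ℂ} (hfg : ∀ z ∈ L, f z = g z) (h : Apn L r f) :
    Apn L r g := by
  obtain ⟨C, hC⟩ := h
  refine ⟨C, fun n => ?_⟩
  obtain ⟨p, hp, hp2⟩ := hC n
  exact ⟨p, hp, fun z hz => hfg z hz ▸ hp2 z hz⟩

theorem apx_congr {L : Set ℂ} {r : ℝ} {f g : ℂ → ℂ} (hfg : ∀ z ∈ L, f z = g z) (h : Apx L r f) :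
    Apx L r g := by
  obtain ⟨δ, C, hδ, hC, hs⟩ := h
  exact ⟨δ, C, hδ, hC, fun z hz => hfg z hz ▸ hs z hz⟩

theorem apn_of_steps {L : Set ℂ} {r : ℝ} {f : ℂ → ℂ} (h0 : 0 < r) (h1 : r < 1) (N : ℕ) (hN : 1 ≤ N)
    (C : ℝ) (h : ∀ k : ℕ, ∃ p : Polynomial ℂ, p.natDegree ≤ N * k ∧
      ∀ z ∈ L, ‖f z - p.eval z‖ ≤ C * (r ^ N) ^ k) : Apn L r f := by
  refine ⟨|C| * (r ^ N)⁻¹, fun n => ?_⟩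
  obtain ⟨p, hp, hp2⟩ := h (n / N)
  refine ⟨p, hp.trans (Nat.mul_div_le n N), fun z hz => (hp2 z hz).trans ?_⟩
  have e1 : r ^ (N * (n / N + 1)) ≤ r ^ n :=
    pow_le_pow_of_le_one h0.le h1.le (Nat.lt_mul_div_succ n hN).le
  rw [mul_assoc]
  have e2 : (r ^ N) ^ (n / N) ≤ (r ^ N)⁻¹ * r ^ n := by
    rw [le_inv_mul_iff₀ (by positivity), ← pow_mul, ← pow_add]
    rw [show N + N * (n / N) = N * (n / N + 1) by ring]; exact e1
  have : C ≤ |C| := le_abs_self C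
  gcongr

theorem succ_mul_pow_bound {r s : ℝ} (h0 : 0 < r) (hrs : r < s) :
    ∃ A : ℝ, 0 ≤ A ∧ ∀ n : ℕ, ((n : ℝ) + 1) * r ^ n ≤ A * s ^ n := by
  have hs : 0 < s := h0.trans hrs
  have hq : |r / s| < 1 := by
    rw [abs_of_pos (by positivity), div_lt_one hs]; exact hrs
  have ht : Tendsto (fun n : ℕ => (n : ℝ) * (r / s) ^ n + (r / s) ^ n) atTop (𝓝 (0 + 0)) := by
    refine Tendsto.add ?_ ?_
    · exact tendsto_self_mul_const_pow_of_abs_lt_one hq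
    · exact tendsto_pow_atTop_nhds_zero_of_abs_lt_one hq
  obtain ⟨A, hA⟩ := ht.bddAbove_range
  have hA' : ∀ n : ℕ, (n : ℝ) * (r / s) ^ n + (r / s) ^ n ≤ A := fun n => hA ⟨n, rfl⟩
  refine ⟨A, ?_, fun n => ?_⟩
  · have := hA' 0; simp at this; linarith
  · have := hA' n
    rw [div_pow] at this
    have e : (n : ℝ) * (r ^ n / s ^ n) + (r ^ n / s ^ n) = (((n:ℝ) + 1) * r ^ n) / s ^ n := by ring
    rw [e, div_le_iff₀ (by positivity)] at this
    exact this

/-- Cauchy product of two polynomial sequences. -/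
noncomputable def conv (δ ε : ℕ → Polynomial ℂ) (m : ℕ) : Polynomial ℂ :=
  ∑ kl ∈ Finset.HasAntidiagonal.antidiagonal m, δ kl.1 * ε kl.2

theorem conv_natDegree (δ ε : ℕ → Polynomial ℂ) (hδ : ∀ j, (δ j).natDegree ≤ j)
    (hε : ∀ j, (ε j).natDegree ≤ j) (m : ℕ) : (conv δ ε m).natDegree ≤ m := by
  refine Polynomial.natDegree_sum_le_of_forall_le _ _ fun kl hkl => ?_
  rw [Finset.HasAntidiagonal.mem_antidiagonal] at hkl
  refine Polynomial.natDegree_mul_le.trans ?_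
  have := hδ kl.1
  have := hε kl.2
  omega

theorem conv_bound {L : Set ℂ} {r C D : ℝ} (δ ε : ℕ → Polynomial ℂ) (h0 : 0 < r)
    (hδ : ∀ j, ∀ z ∈ L, ‖(δ j).eval z‖ ≤ C * r ^ j) (hε : ∀ j, ∀ z ∈ L, ‖(ε j).eval z‖ ≤ D * r ^ j)
    (m : ℕ) (z : ℂ) (hz : z ∈ L) : ‖(conv δ ε m).eval z‖ ≤ (|C| * |D|) * (((m : ℝ) + 1) * r ^ m) := by
  rw [conv, Polynomial.eval_finsetSum]
  refine (norm_sum_le _ _).trans ?_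
  have : ∀ kl ∈ Finset.HasAntidiagonal.antidiagonal m, ‖(δ kl.1 * ε kl.2).eval z‖ ≤ |C| * |D| * r ^ m := by
    intro kl hkl
    rw [Finset.HasAntidiagonal.mem_antidiagonal] at hkl
    rw [Polynomial.eval_mul, norm_mul, ← hkl, pow_add]
    calc _ ≤ (|C| * r ^ kl.1) * (|D| * r ^ kl.2) := by
          have h1 := hδ kl.1 z hz
          have h2 := hε kl.2 z hz
          have : C ≤ |C| := le_abs_self C
          have : D ≤ |D| := le_abs_self D
          have h3 : C * r ^ kl.1 ≤ |C| * r ^ kl.1 := by gcongr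
          have h4 : D * r ^ kl.2 ≤ |D| * r ^ kl.2 := by gcongr
          exact mul_le_mul (h1.trans h3) (h2.trans h4) (norm_nonneg _) (by positivity)
      _ = _ := by ring
  refine (Finset.sum_le_card_nsmul _ _ _ this).trans (le_of_eq ?_)
  rw [Finset.Nat.card_antidiagonal, nsmul_eq_mul]
  push_cast; ring

theorem conv_hasSum (δ ε : ℕ → Polynomial ℂ) (z : ℂ) (u v : ℂ)
    (h1 : HasSum (fun j => (δ j).eval z) u) (h2 : HasSum (fun j => (ε j).eval z) v) :
    HasSum (fun j => (conv δ ε j).eval z) (u * v) := by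
  have n1 := h1.summable.norm
  have n2 := h2.summable.norm
  have h3 := tsum_mul_tsum_eq_tsum_sum_antidiagonal_of_summable_norm n1 n2
  have h4 := summable_norm_sum_mul_antidiagonal_of_summable_norm n1 n2
  rw [h1.tsum_eq, h2.tsum_eq] at h3
  have h5 : (fun j => (conv δ ε j).eval z) =
      fun n => ∑ kl ∈ Finset.HasAntidiagonal.antidiagonal n, (δ kl.1).eval z * (ε kl.2).eval z := by
    ext n; simp [conv, Polynomial.eval_finsetSum]
  rw [h5, h3]
  exact h4.of_norm.hasSum

theorem apx_mul {L : Set ℂ} {r s : ℝ} {f g : ℂ → ℂ} (h0 : 0 < r) (hrs : r < s)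
    (hf : Apx L r f) (hg : Apx L r g) : Apx L s (fun z => f z * g z) := by
  obtain ⟨δ, C, hδ, hC, hs⟩ := hf
  obtain ⟨ε, D, hε, hD, ht⟩ := hg
  obtain ⟨A, hA0, hA⟩ := succ_mul_pow_bound h0 hrs
  refine ⟨conv δ ε, |C| * |D| * A, conv_natDegree δ ε hδ hε, fun j z hz => ?_, fun z hz =>
    conv_hasSum δ ε z _ _ (hs z hz) (ht z hz)⟩
  refine (conv_bound δ ε h0 hC hD j z hz).trans ?_
  have := hA j
  rw [mul_assoc _ A]
  gcongr

theorem apx_add {L : Set ℂ} {r : ℝ} {f g : ℂ → ℂ}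
    (hf : Apx L r f) (hg : Apx L r g) : Apx L r (fun z => f z + g z) := by
  obtain ⟨δ, C, hδ, hC, hs⟩ := hf
  obtain ⟨ε, D, hε, hD, ht⟩ := hg
  refine ⟨fun j => δ j + ε j, C + D, fun j => Polynomial.natDegree_add_le_of_le (hδ j) (hε j) |>.trans (by simp),
    fun j z hz => ?_, fun z hz => ?_⟩
  · rw [Polynomial.eval_add, add_mul]
    exact (norm_add_le _ _).trans (add_le_add (hC j z hz) (hD j z hz))
  · simpa using (hs z hz).add (ht z hz)

theorem apx_poly {L : Set ℂ} {r : ℝ} (hL : IsCompact L) (h0 : 0 < r) (h1 : r < 1) (q : Polynomial ℂ) :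
    Apx L r (fun z => q.eval z) := by
  apply apx_of_apn h0 h1
  obtain ⟨M, hM⟩ := hL.exists_bound_of_continuousOn (f := fun z => q.eval z) (by fun_prop)
  refine ⟨|M| * (r ^ q.natDegree)⁻¹, fun n => ?_⟩
  by_cases h : q.natDegree ≤ n
  · exact ⟨q, h, fun z hz => by simp; positivity⟩
  · refine ⟨0, by simp, fun z hz => ?_⟩
    simp only [Polynomial.eval_zero, sub_zero]
    refine (hM z hz).trans ((le_abs_self M).trans ?_)
    rw [mul_assoc]
    refine le_mul_of_one_le_right (abs_nonneg _) ?_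
    rw [le_inv_mul_iff₀ (by positivity), mul_one]
    exact pow_le_pow_of_le_one h0.le h1.le (by omega)

/-- Approximable at every rate in `(r, 1)`. -/
def AP (L : Set ℂ) (r : ℝ) (f : ℂ → ℂ) : Prop := ∀ s, r < s → s < 1 → Apx L s f

theorem AP.mul {L : Set ℂ} {r : ℝ} {f g : ℂ → ℂ} (h0 : 0 ≤ r)
    (hf : AP L r f) (hg : AP L r g) : AP L r (fun z => f z * g z) := by
  intro s h1 h2
  have := apx_mul (r := (r + s)/2) (s := s) (by linarith) (by linarith)
    (hf ((r+s)/2) (by linarith) (by linarith)) (hg ((r+s)/2) (by linarith) (by linarith))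
  exact this

theorem AP.add {L : Set ℂ} {r : ℝ} {f g : ℂ → ℂ}
    (hf : AP L r f) (hg : AP L r g) : AP L r (fun z => f z + g z) :=
  fun s h1 h2 => apx_add (hf s h1 h2) (hg s h1 h2)

theorem AP.poly {L : Set ℂ} {r : ℝ} (hL : IsCompact L) (h0 : 0 ≤ r) (q : Polynomial ℂ) :
    AP L r (fun z => q.eval z) :=
  fun _ h1 h2 => apx_poly hL (by linarith) h2 q

theorem AP.congr {L : Set ℂ} {r : ℝ} {f g : ℂ → ℂ} (hfg : ∀ z ∈ L, f z = g z) (h : AP L r f) :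
    AP L r g := fun s h1 h2 => apx_congr hfg (h s h1 h2)

theorem AP.prod {L : Set ℂ} {r : ℝ} (hL : IsCompact L) (h0 : 0 ≤ r) {ι : Type*} (t : Finset ι)
    (f : ι → ℂ → ℂ) (hf : ∀ i ∈ t, AP L r (f i)) : AP L r (fun z => ∏ i ∈ t, f i z) := by
  classical
  induction t using Finset.induction_on with
  | empty => simpa using AP.poly hL h0 (1 : Polynomial ℂ)
  | insert i t hi ih =>
    simp only [Finset.prod_insert hi]
    exact AP.mul h0 (hf i (by simp)) (ih fun j hj => hf j (by simp [hj]))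

theorem AP.sum {L : Set ℂ} {r : ℝ} (hL : IsCompact L) (h0 : 0 ≤ r) {ι : Type*} (t : Finset ι)
    (f : ι → ℂ → ℂ) (hf : ∀ i ∈ t, AP L r (f i)) : AP L r (fun z => ∑ i ∈ t, f i z) := by
  classical
  induction t using Finset.induction_on with
  | empty => simpa using AP.poly hL h0 (0 : Polynomial ℂ)
  | insert i t hi ih =>
    simp only [Finset.sum_insert hi]
    exact AP.add (hf i (by simp)) (ih fun j hj => hf j (by simp [hj]))

theorem char_lemma {L : Set ℂ} (hL : IsCompact L) {r C Φ : ℝ} {a : ℂ} (h0 : 0 < r) (h1 : r < 1)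
    (δ : ℕ → Polynomial ℂ) (h : ℂ → ℂ) (hδ : ∀ j, (δ j).natDegree ≤ j)
    (hC : ∀ j, ∀ z ∈ L, ‖(δ j).eval z‖ ≤ C * r ^ j)
    (hs : ∀ z ∈ L, HasSum (fun j => (δ j).eval z) (h z)) (hΦ : 1 ≤ Φ) (hrΦ : r * Φ < 1)
    (hB : ∀ (n : ℕ) (Q : Polynomial ℂ) (M : ℝ), Q.natDegree ≤ n →
      (∀ z ∈ L, ‖Q.eval z‖ ≤ M) → ‖Q.eval a‖ ≤ M * Φ ^ n)
    (D : Polynomial ℂ) (hsq : ∀ z ∈ L, h z * h z = D.eval z * h z) :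
    ∃ v : ℂ, HasSum (fun j => (δ j).eval a) v ∧ v * v = D.eval a * v ∧
      ∀ n : ℕ, ‖∑ j ∈ Finset.range n, (δ j).eval a - v‖ ≤ C * (r * Φ) ^ n / (1 - r * Φ) := by
  have hΦ0 : 0 < Φ := by linarith
  have hb : ∀ j, ‖(δ j).eval a‖ ≤ C * (r * Φ) ^ j := by
    intro j
    have := hB j (δ j) _ (hδ j) (hC j)
    rwa [mul_assoc, ← mul_pow] at this
  have hsum : Summable (fun j => (δ j).eval a) :=
    Summable.of_norm_bounded ((summable_geometric_of_lt_one (by positivity) hrΦ).mul_left C) hb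
  obtain ⟨v, hv⟩ := hsum
  refine ⟨v, hv, ?_, norm_sub_le_of_geometric_bound_of_hasSum hrΦ hb hv⟩
  obtain ⟨r2, hr2, hr2'⟩ : ∃ r2, r < r2 ∧ r2 * Φ < 1 := by
    have : r < 1 / Φ := by rwa [lt_div_iff₀ hΦ0]
    obtain ⟨r2, e1, e2⟩ := exists_between this
    exact ⟨r2, e1, by rwa [lt_div_iff₀ hΦ0] at e2⟩
  have hr20 : 0 < r2 := h0.trans hr2
  have hr21 : r2 < 1 := by nlinarith
  obtain ⟨A, hA0, hA⟩ := succ_mul_pow_bound h0 hr2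
  obtain ⟨MD, hMD⟩ := hL.exists_bound_of_continuousOn (f := fun z => D.eval z) (by fun_prop)
  have hconvb : ∀ j, ∀ z ∈ L, ‖(conv δ δ j).eval z‖ ≤ (|C| * |C| * A) * r2 ^ j := by
    intro j z hz
    refine (conv_bound δ δ h0 hC hC j z hz).trans ?_
    have := hA j
    rw [mul_assoc _ A]
    gcongr
  have hC2 : ∀ j, ∀ z ∈ L, ‖(δ j).eval z‖ ≤ |C| * r2 ^ j := by
    intro j z hz
    refine (hC j z hz).trans ?_
    have : C ≤ |C| := le_abs_self C
    gcongr
  set E : ℝ := (|C| * |C| * A) / (1 - r2) + |MD| * (|C| / (1 - r2)) with hE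
  let s : ℕ → Polynomial ℂ := fun n =>
    ∑ m ∈ Finset.range (n + 1), conv δ δ m - D * ∑ m ∈ Finset.range (n + 1), δ m
  have hsL : ∀ n, ∀ z ∈ L, ‖(s n).eval z‖ ≤ E * r2 ^ (n + 1) := by
    intro n z hz
    have e1 := norm_sub_le_of_geometric_bound_of_hasSum hr21 (fun j => hconvb j z hz)
      (conv_hasSum δ δ z _ _ (hs z hz) (hs z hz)) (n + 1)
    have e2 := norm_sub_le_of_geometric_bound_of_hasSum hr21 (fun j => hC2 j z hz) (hs z hz) (n + 1)
    have e3 : (s n).eval z = (∑ m ∈ Finset.range (n + 1), (conv δ δ m).eval z - h z * h z) -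
        D.eval z * (∑ m ∈ Finset.range (n + 1), (δ m).eval z - h z) := by
      simp only [s, Polynomial.eval_sub, Polynomial.eval_mul, Polynomial.eval_finsetSum]
      rw [hsq z hz]; ring
    rw [e3]
    refine (norm_sub_le _ _).trans ?_
    rw [norm_mul]
    have e4 : ‖D.eval z‖ ≤ |MD| := (hMD z hz).trans (le_abs_self _)
    have e5 := mul_le_mul e4 e2 (norm_nonneg _) (abs_nonneg _)
    refine (add_le_add e1 e5).trans (le_of_eq ?_)
    rw [hE]; ring
  have hsdeg : ∀ n, (s n).natDegree ≤ n + D.natDegree := by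
    intro n
    refine (Polynomial.natDegree_sub_le _ _).trans (max_le ?_ ?_)
    · exact (natDegree_sum_range_le _ (conv_natDegree δ δ hδ hδ) n).trans (by omega)
    · refine Polynomial.natDegree_mul_le.trans ?_
      have := natDegree_sum_range_le δ hδ n
      omega
  have hsa : ∀ n, ‖(s n).eval a‖ ≤ (E * r2 * Φ ^ D.natDegree) * (r2 * Φ) ^ n := by
    intro n
    refine (hB _ (s n) _ (hsdeg n) (hsL n)).trans (le_of_eq ?_)
    rw [pow_succ, pow_add, mul_pow]; ring
  have ht0 : Tendsto (fun n => (s n).eval a) atTop (𝓝 0) := by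
    rw [tendsto_zero_iff_norm_tendsto_zero]
    have ht : Tendsto (fun n : ℕ => (E * r2 * Φ ^ D.natDegree) * (r2 * Φ) ^ n) atTop (𝓝 0) := by
      simpa using (tendsto_pow_atTop_nhds_zero_of_lt_one (by positivity) hr2').const_mul
        (E * r2 * Φ ^ D.natDegree)
    exact squeeze_zero (fun _ => norm_nonneg _) hsa ht
  have ht1 : Tendsto (fun n => (s n).eval a) atTop (𝓝 (v * v - D.eval a * v)) := by
    simp only [s, Polynomial.eval_sub, Polynomial.eval_mul, Polynomial.eval_finsetSum]
    refine Tendsto.sub ?_ (Tendsto.const_mul _ ?_)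
    · exact (tendsto_add_atTop_iff_nat 1).2 (conv_hasSum δ δ a _ _ hv hv).tendsto_sum_nat
    · exact (tendsto_add_atTop_iff_nat 1).2 hv.tendsto_sum_nat
  exact sub_eq_zero.1 (tendsto_nhds_unique ht1 ht0)

theorem exists_factor (p : Polynomial ℂ) (a : ℂ) (hp : p.eval a = 0) :
    ∃ s : Polynomial ℂ, s.natDegree ≤ p.natDegree ∧ ∀ z, p.eval z = (z - a) * s.eval z := by
  refine ⟨p /ₘ (Polynomial.X - Polynomial.C a), ?_, fun z => ?_⟩
  · rw [Polynomial.natDegree_divByMonic _ (Polynomial.monic_X_sub_C a)]; omega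
  · conv_lhs => rw [← (Polynomial.mul_divByMonic_eq_iff_isRoot (p := p) (a := a)).2 hp]
    simp

/-- Step `X ⇒ conclusion` when `a ∉ L`. -/
theorem div_outside {L : Set ℂ} (hL : IsCompact L) {r : ℝ} (h0 : 0 < r) {a : ℂ} (ha : a ∉ L)
    (f : ℂ → ℂ) (C : ℝ) (h : ∀ n : ℕ, ∃ p : Polynomial ℂ, p.natDegree ≤ n ∧ p.eval a = 0 ∧
      ∀ z ∈ L, ‖(z - a) * f z - p.eval z‖ ≤ C * r ^ n) : Apn L r f := by
  obtain ⟨d, hd, hd2⟩ : ∃ d > 0, ∀ z ∈ L, d ≤ ‖z - a‖ := by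
    have : Lᶜ ∈ 𝓝 a := hL.isClosed.isOpen_compl.mem_nhds ha
    obtain ⟨d, hd, hd2⟩ := Metric.mem_nhds_iff.1 this
    refine ⟨d, hd, fun z hz => ?_⟩
    by_contra hlt
    exact hd2 (by rw [mem_ball, dist_eq_norm]; exact not_le.1 hlt) hz
  refine ⟨|C| / d, fun n => ?_⟩
  obtain ⟨p, hp, hpa, hp2⟩ := h n
  obtain ⟨s, hs, hs2⟩ := exists_factor p a hpa
  refine ⟨s, hs.trans hp, fun z hz => ?_⟩
  have e1 := hp2 z hz
  rw [hs2, ← mul_sub, norm_mul] at e1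
  have e2 := hd2 z hz
  rw [div_mul_eq_mul_div, le_div_iff₀ hd]
  have : C * r ^ n ≤ |C| * r ^ n := by have := le_abs_self C; gcongr
  nlinarith [norm_nonneg (f z - s.eval z)]

/-- Step `X ⇒ conclusion` when `a ∈ L`. -/
theorem div_inside {L : Set ℂ} {r s : ℝ} (h0 : 0 < r) (hrs : r < s) {a : ℂ} 
    (E : Polynomial ℂ) (χ : ℂ → ℂ) (K : Set ℂ) (hKL : K ⊆ L) (hK : IsPreconnected K) (hnt : K.Nontrivial)
    (haK : a ∈ K) (ρ : ℝ) (hρ : 0 < ρ) (hKρ : ∀ z ∈ L, ‖z - a‖ < ρ → z ∈ K) (c : ℂ) (hc : ∀ z ∈ K, χ z = c)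
    (C : ℝ) (h : ∀ n : ℕ, ∃ p : Polynomial ℂ, p.natDegree ≤ n ∧ p.eval a = 0 ∧
      ∀ z ∈ L, ‖(z - a) * (E.eval z * χ z) - p.eval z‖ ≤ C * r ^ n) :
    Apn L s (fun z => E.eval z * χ z) := by
  have hη : 1 < s / r := by rwa [one_lt_div h0]
  have hs0 : 0 < s := h0.trans hrs
  obtain ⟨δ, hδ, hreg⟩ := regular_continuum K hK hnt a haK (s / r) hη
  obtain ⟨t, ht0, htδ, htρ⟩ : ∃ t > 0, t ≤ δ ∧ t ≤ ρ := ⟨min δ ρ, lt_min hδ hρ, min_le_left _ _, min_le_right _ _⟩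
  refine ⟨|C| / t * (s / r) ^ (E.natDegree + 1), fun n => ?_⟩
  obtain ⟨p, hp, hpa, hp2⟩ := h n
  obtain ⟨u, hu, hu2⟩ := exists_factor p a hpa
  refine ⟨u, hu.trans hp, fun z hz => ?_⟩
  have hCa : C * r ^ n ≤ |C| * r ^ n := by have := le_abs_self C; gcongr
  have key : ∀ w ∈ L, ‖w - a‖ * ‖E.eval w * χ w - u.eval w‖ ≤ |C| * r ^ n := by
    intro w hw
    have e1 := hp2 w hw
    rw [hu2, ← mul_sub, norm_mul] at e1
    exact e1.trans hCa
  have e5 : (1:ℝ) ≤ (s / r) ^ (E.natDegree + 1) := one_le_pow₀ hη.le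
  by_cases hzt : ‖z - a‖ < t
  · have hzK : z ∈ K := hKρ z hz (hzt.trans_le htρ)
    beta_reduce
    rw [hc z hzK]
    set T : Polynomial ℂ := E * Polynomial.C c - u with hT
    have hTe : ∀ w, T.eval w = E.eval w * c - u.eval w := by intro w; simp [hT]
    set Q : Polynomial ℂ := (Polynomial.X - Polynomial.C a) * T with hQ
    have hQe : ∀ w, Q.eval w = (w - a) * T.eval w := by intro w; simp [hQ]
    have hQd : Q.natDegree ≤ n + (E.natDegree + 1) := by
      refine Polynomial.natDegree_mul_le.trans ?_
      have e2 : T.natDegree ≤ n + E.natDegree := by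
        refine (Polynomial.natDegree_sub_le _ _).trans (max_le ?_ ?_)
        · exact (Polynomial.natDegree_mul_C_le _ _).trans (by omega)
        · exact (hu.trans hp).trans (by omega)
      rw [Polynomial.natDegree_X_sub_C]; omega
    have hQK : ∀ w ∈ K, ‖Q.eval w‖ ≤ |C| * r ^ n := by
      intro w hw
      have := key w (hKL hw)
      rw [hc w hw] at this
      rw [hQe, norm_mul, hTe]; exact this
    have hQb := hreg _ Q _ hQd hQK
    have hmax : ‖T.eval z‖ ≤ |C| * r ^ n * (s / r) ^ (n + (E.natDegree + 1)) / t := by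
      refine Complex.norm_le_of_forall_mem_frontier_norm_le (f := fun w => T.eval w)
        (U := ball a t) isBounded_ball ?_ (fun w hw => ?_) (subset_closure (by rwa [mem_ball, dist_eq_norm]))
      · exact T.differentiable.diffContOnCl
      · rw [frontier_ball _ ht0.ne', mem_sphere, dist_eq_norm] at hw
        have := hQb w (by rw [hw]; exact htδ)
        rw [hQe, norm_mul, hw] at this
        rw [le_div_iff₀ ht0, mul_comm]; exact this
    rw [← hTe]
    refine hmax.trans (le_of_eq ?_)
    rw [pow_add, div_pow s r n]
    field_simp
  · push Not at hzt
    have e3 := key z hz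
    have e4 : ‖E.eval z * χ z - u.eval z‖ ≤ |C| / t * r ^ n := by
      rw [div_mul_eq_mul_div, le_div_iff₀ ht0]
      nlinarith [norm_nonneg (E.eval z * χ z - u.eval z)]
    refine e4.trans ?_
    calc |C| / t * r ^ n ≤ |C| / t * s ^ n := by gcongr
      _ = |C| / t * 1 * s ^ n := by ring
      _ ≤ _ := by gcongr

/-- Points where polynomials bounded on `L` are large give approximations of `1/(z-a)`. -/
theorem apn_inv {L : Set ℂ} (hL : IsCompact L) {r : ℝ} (h0 : 0 < r) (h1 : r < 1) {a : ℂ} (ha : a ∉ L)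
    (N : ℕ) (hN : 1 ≤ N) (P : Polynomial ℂ) (hP : P.natDegree ≤ N) (hPL : ∀ z ∈ L, ‖P.eval z‖ ≤ 1)
    (hPa : r⁻¹ ^ N ≤ ‖P.eval a‖) : Apn L r (fun z => (z - a)⁻¹) := by
  obtain ⟨d, hd, hd2⟩ : ∃ d > 0, ∀ z ∈ L, d ≤ ‖z - a‖ := by
    have : Lᶜ ∈ 𝓝 a := hL.isClosed.isOpen_compl.mem_nhds ha
    obtain ⟨d, hd, hd2⟩ := Metric.mem_nhds_iff.1 this
    refine ⟨d, hd, fun z hz => ?_⟩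
    by_contra hlt
    exact hd2 (by rw [mem_ball, dist_eq_norm]; exact not_le.1 hlt) hz
  have hPa0 : 0 < ‖P.eval a‖ := lt_of_lt_of_le (by positivity) hPa
  have hPa1 : P.eval a ≠ 0 := norm_pos_iff.1 hPa0
  refine apn_of_steps h0 h1 N hN (1 / d) fun k => ?_
  obtain ⟨s, hs, hs2⟩ := exists_factor (1 - Polynomial.C ((P.eval a ^ k)⁻¹) * P ^ k) a
    (by simp [hPa1])
  refine ⟨s, hs.trans ?_, fun z hz => ?_⟩
  · refine (Polynomial.natDegree_sub_le _ _).trans (max_le (by simp) ?_)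
    refine (Polynomial.natDegree_C_mul_le _ _).trans (Polynomial.natDegree_pow_le.trans ?_)
    rw [mul_comm]; gcongr
  · have hza : z - a ≠ 0 := by
      intro h; rw [sub_eq_zero] at h; exact ha (h ▸ hz)
    have e1 : (z - a)⁻¹ - s.eval z = (z - a)⁻¹ * ((P.eval a ^ k)⁻¹ * P.eval z ^ k) := by
      have := hs2 z
      simp only [Polynomial.eval_sub, Polynomial.eval_one, Polynomial.eval_mul, Polynomial.eval_C,
        Polynomial.eval_pow] at this
      rw [show s.eval z = (z - a)⁻¹ * ((z - a) * s.eval z) by field_simp, ← this]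
      ring
    rw [e1, norm_mul, norm_mul, norm_inv, norm_inv, norm_pow, norm_pow]
    have e2 : ‖z - a‖⁻¹ ≤ 1 / d := by
      rw [one_div]; exact inv_anti₀ hd (hd2 z hz)
    have e3 : (‖P.eval a‖ ^ k)⁻¹ ≤ (r ^ N) ^ k := by
      rw [inv_le_comm₀ (by positivity) (by positivity), ← inv_pow, ← inv_pow]
      gcongr
    have e4 : ‖P.eval z‖ ^ k ≤ 1 := pow_le_one₀ (norm_nonneg _) (hPL z hz)
    calc _ ≤ 1 / d * ((r ^ N) ^ k * 1) := by gcongr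
      _ = _ := by ring

/-- The main division step for a point outside `L`. -/
theorem div_out_main {L : Set ℂ} (hL : IsCompact L) (hne : L.Nonempty) {r s : ℝ} (h0 : 0 ≤ r) (hrs : r < s) (hs1 : s < 1)
    {a : ℂ} (ha : a ∉ L) (E : Polynomial ℂ) (χ : ℂ → ℂ) (hχ : ∀ z ∈ L, χ z * χ z = χ z)
    (h : AP L r (fun z => (z - a) * (E.eval z * χ z))) : Apx L s (fun z => E.eval z * χ z) := by
  obtain ⟨r1, hr1, hr1s⟩ := exists_between hrs
  obtain ⟨r2, hr2, hr2s⟩ := exists_between hr1s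
  have hr10 : 0 < r1 := lt_of_le_of_lt h0 hr1
  have hr20 : 0 < r2 := hr10.trans hr2
  set S : Set ℝ := {x : ℝ | 1 ≤ x ∧ ∃ N : ℕ, 1 ≤ N ∧ ∃ P : Polynomial ℂ, P.natDegree ≤ N ∧
    (∀ z ∈ L, ‖P.eval z‖ ≤ 1) ∧ x ^ N ≤ ‖P.eval a‖} with hS
  by_cases hcase : r2⁻¹ ∈ S
  · obtain ⟨-, N, hN, P, hP, hPL, hPa⟩ := hcase
    have e1 := apx_of_apn hr20 (by linarith) (apn_inv hL hr20 (by linarith) ha N hN P hP hPL hPa)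
    have e2 := apx_mul hr20 hr2s e1 (h r2 (by linarith) (by linarith))
    refine apx_congr (fun z hz => ?_) e2
    have hza : z - a ≠ 0 := by
      intro h; rw [sub_eq_zero] at h; exact ha (h ▸ hz)
    field_simp
  have hbdd : ∀ x ∈ S, x ≤ r2⁻¹ := by
    rintro x ⟨hx1, N, hN, P, hP, hPL, hPa⟩
    by_contra hlt
    push Not at hlt
    refine hcase ⟨(one_le_inv₀ hr20).2 (by linarith), N, hN, P, hP, hPL, le_trans ?_ hPa⟩
    gcongr
  have hBA : BddAbove S := ⟨_, hbdd⟩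
  have h1S : (1:ℝ) ∈ S := ⟨le_rfl, 1, le_rfl, 1, by simp, by simp, by simp⟩
  set Φ := sSup S with hΦ
  have hΦ1 : 1 ≤ Φ := le_csSup hBA h1S
  have hΦ2 : Φ ≤ r2⁻¹ := csSup_le ⟨1, h1S⟩ hbdd
  have hB : ∀ (n : ℕ) (Q : Polynomial ℂ) (M : ℝ), Q.natDegree ≤ n →
      (∀ z ∈ L, ‖Q.eval z‖ ≤ M) → ‖Q.eval a‖ ≤ M * Φ ^ n := by
    intro n Q M hQ hM
    obtain ⟨z0, hz0⟩ := hne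
    have hM0 : 0 ≤ M := (norm_nonneg _).trans (hM z0 hz0)
    rcases Nat.eq_zero_or_pos n with rfl | hn
    · have : Q = Polynomial.C (Q.coeff 0) := Polynomial.eq_C_of_natDegree_le_zero hQ
      have hz := hM z0 hz0
      rw [this] at hz ⊢
      simpa using hz
    · refine le_of_forall_pos_le_add fun ε hε => ?_
      set M' := M + ε / Φ ^ n with hM'
      have hΦn : 0 < Φ ^ n := by positivity
      have hM'0 : 0 < M' := by positivity
      have e1 : ‖Q.eval a‖ / M' ≤ Φ ^ n := by
        by_contra hlt
        push Not at hlt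
        have hge1 : 1 ≤ ‖Q.eval a‖ / M' := (one_le_pow₀ hΦ1).trans hlt.le
        have hx : ((‖Q.eval a‖ / M') ^ ((n:ℝ)⁻¹)) ^ n = ‖Q.eval a‖ / M' :=
          Real.rpow_inv_natCast_pow (by positivity) hn.ne'
        have hmem : (‖Q.eval a‖ / M') ^ ((n:ℝ)⁻¹) ∈ S := by
          refine ⟨Real.one_le_rpow hge1 (by positivity), n, hn, Polynomial.C ((M':ℂ)⁻¹) * Q,
            (Polynomial.natDegree_C_mul_le _ _).trans hQ, fun z hz => ?_, ?_⟩
          · rw [Polynomial.eval_mul, Polynomial.eval_C, norm_mul, norm_inv, Complex.norm_real,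
              Real.norm_of_nonneg hM'0.le, inv_mul_le_iff₀ hM'0, mul_one]
            refine (hM z hz).trans ?_
            rw [hM']; have : 0 < ε / Φ ^ n := by positivity
            linarith
          · rw [hx, Polynomial.eval_mul, Polynomial.eval_C, norm_mul, norm_inv, Complex.norm_real,
              Real.norm_of_nonneg hM'0.le, div_eq_inv_mul]
        have hle := le_csSup hBA hmem
        have : (‖Q.eval a‖ / M') ≤ Φ ^ n := by
          rw [← hx]
          have : 0 ≤ (‖Q.eval a‖ / M') ^ ((n:ℝ)⁻¹) := by positivity
          gcongr
        linarith
      rw [div_le_iff₀ hM'0] at e1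
      refine e1.trans (le_of_eq ?_)
      rw [hM']; field_simp
  have hr1Φ : r1 * Φ < 1 := by
    calc r1 * Φ ≤ r1 * r2⁻¹ := by gcongr
      _ < 1 := by rw [← div_eq_mul_inv, div_lt_one hr20]; exact hr2
  obtain ⟨δ, C, hδ, hC, hsum⟩ := h r1 hr1 (by linarith)
  obtain ⟨v, hv, hv2, htail⟩ := char_lemma hL hr10 (by linarith) δ _ hδ hC hsum hΦ1 hr1Φ hB
    ((Polynomial.X - Polynomial.C a) * E) (by
      intro z hz
      have := hχ z hz
      simp only [Polynomial.eval_mul, Polynomial.eval_sub, Polynomial.eval_X, Polynomial.eval_C]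
      calc _ = (z - a) ^ 2 * E.eval z ^ 2 * (χ z * χ z) := by ring
        _ = _ := by rw [this]; ring)
  have hv0 : v = 0 := by simpa using hv2
  subst hv0
  -- choose a good polynomial
  obtain ⟨x, hxS, hx⟩ : ∃ x ∈ S, Φ * (r1 / r2) < x := by
    refine exists_lt_of_lt_csSup ⟨1, h1S⟩ ?_
    have : r1 / r2 < 1 := by rwa [div_lt_one hr20]
    rw [← hΦ]
    nlinarith
  obtain ⟨hx1, N, hN, P, hP, hPL, hPa⟩ := hxS
  have hx0 : 0 < x := by linarith
  have hPa0 : 0 < ‖P.eval a‖ := lt_of_lt_of_le (by positivity) hPa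
  have hPa1 : P.eval a ≠ 0 := norm_pos_iff.1 hPa0
  have hq : r1 * Φ / x ≤ r2 := by
    rw [div_le_iff₀ hx0]
    have : Φ * (r1 / r2) * r2 ≤ x * r2 := by gcongr
    rw [show Φ * (r1 / r2) * r2 = r1 * Φ by field_simp] at this
    linarith
  have hfin : Apn L r2 (fun z => E.eval z * χ z) := by
    refine div_outside hL hr20 ha _ (|C| * r1 / (1 - r1) + |C| * (r1 * Φ) / (1 - r1 * Φ) * x ^ N) fun n => ?_
    set p := ∑ j ∈ Finset.range (n + 1), δ j with hp
    set k := n / N with hk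
    have hkN : N * k ≤ n := Nat.mul_div_le n N
    have hkN2 : n ≤ N * k + N := (Nat.lt_mul_div_succ n hN).le
    refine ⟨p - Polynomial.C (p.eval a * (P.eval a ^ k)⁻¹) * P ^ k, ?_, ?_, fun z hz => ?_⟩
    · refine (Polynomial.natDegree_sub_le _ _).trans (max_le (natDegree_sum_range_le δ hδ n) ?_)
      refine (Polynomial.natDegree_C_mul_le _ _).trans (Polynomial.natDegree_pow_le.trans ?_)
      calc k * P.natDegree ≤ k * N := by gcongr
        _ ≤ n := by rw [mul_comm]; exact hkN
    · simp [hPa1]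
    · have hCa : C ≤ |C| := le_abs_self C
      have e1 := norm_sub_le_of_geometric_bound_of_hasSum (by linarith : r1 < 1) (fun j => hC j z hz) (hsum z hz) (n + 1)
      rw [← Polynomial.eval_finsetSum, ← hp] at e1
      have e2 := htail (n + 1)
      rw [← Polynomial.eval_finsetSum, ← hp, sub_zero] at e2
      have e3 : (z - a) * (E.eval z * χ z) - (p - Polynomial.C (p.eval a * (P.eval a ^ k)⁻¹) * P ^ k).eval z
          = -(p.eval z - (z - a) * (E.eval z * χ z)) + p.eval a * (P.eval a ^ k)⁻¹ * P.eval z ^ k := by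
        simp only [Polynomial.eval_sub, Polynomial.eval_mul, Polynomial.eval_C, Polynomial.eval_pow]
        ring
      rw [e3]
      refine (norm_add_le _ _).trans ?_
      rw [norm_neg, add_mul]
      have h1r : 0 < 1 - r1 := by linarith
      have h1rΦ : 0 < 1 - r1 * Φ := by linarith
      refine add_le_add (e1.trans ?_) ?_
      · calc C * r1 ^ (n + 1) / (1 - r1) ≤ |C| * (r2 ^ n * r1) / (1 - r1) := by
              rw [pow_succ]; gcongr
          _ = _ := by ring
      · rw [norm_mul, norm_mul, norm_inv, norm_pow, norm_pow]
        have e4 : ‖P.eval z‖ ^ k ≤ 1 := pow_le_one₀ (norm_nonneg _) (hPL z hz)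
        have e5 : (‖P.eval a‖ ^ k)⁻¹ ≤ x ^ N / x ^ n := by
          rw [le_div_iff₀ (by positivity), inv_mul_le_iff₀ (by positivity)]
          calc x ^ n ≤ x ^ (N * k + N) := pow_le_pow_right₀ hx1 hkN2
            _ = (x ^ N) ^ k * x ^ N := by rw [pow_add, pow_mul]
            _ ≤ ‖P.eval a‖ ^ k * x ^ N := by gcongr
        have e6 : ‖p.eval a‖ ≤ |C| * (r1 * Φ) ^ (n + 1) / (1 - r1 * Φ) := e2.trans (by gcongr)
        calc _ ≤ |C| * (r1 * Φ) ^ (n + 1) / (1 - r1 * Φ) * (x ^ N / x ^ n) * 1 := by gcongr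
          _ = |C| * (r1 * Φ) / (1 - r1 * Φ) * x ^ N * (r1 * Φ / x) ^ n := by
              rw [div_pow, pow_succ]; field_simp
          _ ≤ _ := by gcongr
  refine apx_of_apn (hr20.trans hr2s) hs1 ?_
  obtain ⟨C', hC'⟩ := hfin
  refine ⟨|C'|, fun n => ?_⟩
  obtain ⟨p, hp, hp2⟩ := hC' n
  refine ⟨p, hp, fun z hz => (hp2 z hz).trans ?_⟩
  have : C' ≤ |C'| := le_abs_self _
  gcongr

/-- Local structure of `L` and `χ`. -/
def Good (L : Set ℂ) (χ : ℂ → ℂ) : Prop :=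
  (∀ z ∈ L, χ z * χ z = χ z) ∧ ∀ a ∈ L, ∃ K ⊆ L, IsPreconnected K ∧ K.Nontrivial ∧ a ∈ K ∧
    (∃ ρ > 0, ∀ z ∈ L, ‖z - a‖ < ρ → z ∈ K) ∧ ∃ c, ∀ z ∈ K, χ z = c

theorem AP.div_linear {L : Set ℂ} (hL : IsCompact L) (hne : L.Nonempty) {r : ℝ} (h0 : 0 ≤ r)
    (a : ℂ) (E : Polynomial ℂ) (χ : ℂ → ℂ) (hχ : Good L χ)
    (h : AP L r (fun z => (z - a) * (E.eval z * χ z))) : AP L r (fun z => E.eval z * χ z) := by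
  intro s hrs hs1
  by_cases ha : a ∈ L
  · obtain ⟨K, hKL, hK, hnt, haK, ⟨ρ, hρ, hKρ⟩, c, hc⟩ := hχ.2 a ha
    obtain ⟨r1, hr1, hr1s⟩ := exists_between hrs
    have hr10 : 0 < r1 := lt_of_le_of_lt h0 hr1
    refine apx_of_apn (by linarith) hs1 ?_
    obtain ⟨C, hC⟩ := apn_of_apx hr10 (by linarith) (h r1 hr1 (by linarith))
    refine div_inside (r := r1) hr10 hr1s E χ K hKL hK hnt haK ρ hρ hKρ c hc (C + C) fun n => ?_
    obtain ⟨p, hp, hp2⟩ := hC n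
    refine ⟨p - Polynomial.C (p.eval a), by simpa using hp, by simp, fun z hz => ?_⟩
    have e1 := hp2 z hz
    have e2 := hp2 a ha
    simp only [sub_self, zero_mul, zero_sub, norm_neg] at e2
    rw [Polynomial.eval_sub, Polynomial.eval_C, ← sub_add, add_mul]
    exact (norm_add_le _ _).trans (add_le_add e1 e2)
  · exact div_out_main hL hne h0 hrs hs1 ha E χ hχ.1 h

theorem AP.div_poly {L : Set ℂ} (hL : IsCompact L) (hne : L.Nonempty) {r : ℝ} (h0 : 0 ≤ r)
    (χ : ℂ → ℂ) (hχ : Good L χ) (n : ℕ) : ∀ D : Polynomial ℂ, D.natDegree = n → D ≠ 0 →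
    AP L r (fun z => D.eval z * χ z) → AP L r χ := by
  induction n with
  | zero =>
    intro D hD hD0 h
    have hDc : D = Polynomial.C (D.coeff 0) := Polynomial.eq_C_of_natDegree_eq_zero hD
    have hc : D.coeff 0 ≠ 0 := by
      intro h; rw [h] at hDc; exact hD0 (by simpa using hDc)
    have := AP.mul h0 (AP.poly hL h0 (Polynomial.C (D.coeff 0)⁻¹)) h
    refine AP.congr (fun z _ => ?_) this
    rw [hDc]; simp [hc]
  | succ k ih =>
    intro D hD hD0 h
    obtain ⟨a, ha⟩ := IsAlgClosed.exists_root D (by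
      rw [Polynomial.degree_eq_natDegree hD0, hD]; exact_mod_cast Nat.succ_ne_zero k)
    have hfac := (Polynomial.mul_divByMonic_eq_iff_isRoot (p := D) (a := a)).2 ha
    set E := D /ₘ (Polynomial.X - Polynomial.C a) with hE
    refine ih E ?_ ?_ ?_
    · rw [hE, Polynomial.natDegree_divByMonic _ (Polynomial.monic_X_sub_C a), hD]; simp
    · intro hE0; rw [hE0, mul_zero] at hfac; exact hD0 hfac.symm
    · refine AP.div_linear hL hne h0 a E χ hχ (AP.congr (fun z _ => ?_) h)
      rw [← hfac]; simp [mul_assoc]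

noncomputable def dbar (f : ℂ → ℂ) (w : ℂ) : ℂ := fderiv ℝ f w 1 + Complex.I * fderiv ℝ f w Complex.I

theorem integral_fderiv_zero (f : ℂ → ℂ) (hf : ContDiff ℝ 1 f) (hc : HasCompactSupport f) (v : ℂ) :
    ∫ w, fderiv ℝ f w v = 0 := by
  have hcont : Continuous (fun w => fderiv ℝ f w v) :=
    (hf.continuous_fderiv (by norm_num)).clm_apply continuous_const
  have hcs : HasCompactSupport (fun w => fderiv ℝ f w v) := by
    have := hc.fderiv (𝕜 := ℝ)
    exact this.comp_left (g := fun T : ℂ →L[ℝ] ℂ => T v) (by simp)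
  have := integral_mul_fderiv_eq_neg_fderiv_mul_of_integrable (μ := MeasureTheory.volume) (𝕜 := ℂ)
    (f := fun _ : ℂ => (1:ℂ)) (g := f) (v := v) (by simp)
    (by simpa using hcont.integrable_of_hasCompactSupport hcs)
    (by simpa using hf.continuous.integrable_of_hasCompactSupport hc)
    (by intros; fun_prop) (by intro x _; exact hf.differentiable (by norm_num) x)
  simpa using this

theorem dbar_continuous {f : ℂ → ℂ} (hf : ContDiff ℝ 1 f) : Continuous (dbar f) := by
  have h := hf.continuous_fderiv (by norm_num)
  unfold dbar
  fun_prop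

theorem dbar_eventually_const {f : ℂ → ℂ} {w c : ℂ} (h : ∀ᶠ x in 𝓝 w, f x = c) : dbar f w = 0 := by
  have : f =ᶠ[𝓝 w] fun _ => c := h
  simp [dbar, this.fderiv_eq]

theorem dbar_hasCompactSupport {f : ℂ → ℂ} (hc : HasCompactSupport f) : HasCompactSupport (dbar f) := by
  have := hc.fderiv (𝕜 := ℝ)
  exact this.comp_left (g := fun T : ℂ →L[ℝ] ℂ => T 1 + Complex.I * T Complex.I) (by simp)

theorem integral_dbar_zero (f : ℂ → ℂ) (hf : ContDiff ℝ 1 f) (hc : HasCompactSupport f) :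
    ∫ w, dbar f w = 0 := by
  have hint : ∀ v, MeasureTheory.Integrable (fun w => fderiv ℝ f w v) := by
    intro v
    have hcont : Continuous (fun w => fderiv ℝ f w v) :=
      (hf.continuous_fderiv (by norm_num)).clm_apply continuous_const
    have hcs : HasCompactSupport (fun w => fderiv ℝ f w v) := by
      have := hc.fderiv (𝕜 := ℝ)
      exact this.comp_left (g := fun T : ℂ →L[ℝ] ℂ => T v) (by simp)
    exact hcont.integrable_of_hasCompactSupport hcs
  unfold dbar
  rw [MeasureTheory.integral_add (hint 1) ((hint Complex.I).const_mul _), MeasureTheory.integral_const_mul,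
    integral_fderiv_zero f hf hc, integral_fderiv_zero f hf hc]
  simp

theorem dbar_mul_inv {f : ℂ → ℂ} {w z : ℂ} (hf : DifferentiableAt ℝ f w) (hw : w ≠ z) :
    dbar (fun w => f w * (w - z)⁻¹) w = dbar f w * (w - z)⁻¹ := by
  have hne : w - z ≠ 0 := sub_ne_zero.mpr hw
  have h1 : HasDerivAt (fun w : ℂ => (w - z)⁻¹) (-1 / (w - z)^2) w := by
    have := ((hasDerivAt_id w).sub_const z).inv hne
    exact this
  have h2 := h1.hasFDerivAt.restrictScalars ℝ
  have h3 := hf.hasFDerivAt.mul h2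
  have h4 : fderiv ℝ (fun w => f w * (w - z)⁻¹) w = _ := h3.fderiv
  unfold dbar
  rw [h4]
  simp
  linear_combination (f w * (-1/(w-z)^2)) * Complex.I_mul_I

theorem integral_dbar_mul_inv_zero (f : ℂ → ℂ) (hf : ContDiff ℝ 1 f) (hc : HasCompactSupport f) (z : ℂ)
    (hz : ∀ᶠ w in 𝓝 z, f w = 0) : ∫ w, dbar f w * (w - z)⁻¹ = 0 := by
  have hcd : ContDiff ℝ 1 (fun w => f w * (w - z)⁻¹) := by
    rw [contDiff_iff_contDiffAt]
    intro w
    by_cases hw : w = z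
    · subst hw
      have : (fun x => f x * (x - w)⁻¹) =ᶠ[𝓝 w] fun _ => 0 := by
        filter_upwards [hz] with x hx
        simp [hx]
      exact contDiffAt_const.congr_of_eventuallyEq this
    · have : w - z ≠ 0 := sub_ne_zero.mpr hw
      exact hf.contDiffAt.mul ((contDiffAt_id.sub contDiffAt_const).inv this)
  have h := integral_dbar_zero _ hcd (hc.mul_right)
  rw [← h]
  congr 1
  ext w
  by_cases hw : w = z
  · subst hw
    rw [dbar_eventually_const (f := fun x => f x * (x - w)⁻¹) (c := 0)]
    · simp
    · filter_upwards [hz] with x hx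
      simp [hx]
  · rw [dbar_mul_inv (hf.differentiable (by norm_num) w) hw]

noncomputable def bumpE (t : ℝ) : ℝ := Real.smoothTransition (2 - t)
noncomputable def bumpG (w : ℂ) : ℂ := (bumpE (Complex.normSq w) : ℂ)

theorem bumpE_contDiff : ContDiff ℝ 1 bumpE := by
  unfold bumpE
  exact (Real.smoothTransition.contDiff (n := 1)).comp (contDiff_const.sub contDiff_id)

theorem normSq_hasFDerivAt (w : ℂ) : HasFDerivAt (𝕜 := ℝ) (fun w : ℂ => Complex.normSq w)
    ((2 * w.re) • Complex.reCLM + (2 * w.im) • Complex.imCLM) w := by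
  have h1 := (Complex.reCLM.hasFDerivAt (x := w)).mul (Complex.reCLM.hasFDerivAt (x := w))
  have h2 := (Complex.imCLM.hasFDerivAt (x := w)).mul (Complex.imCLM.hasFDerivAt (x := w))
  have := h1.add h2
  refine (this.congr_of_eventuallyEq ?_).congr_fderiv ?_
  · filter_upwards with x
    simp [Complex.normSq_apply]
  · ext v <;> simp <;> ring

theorem bumpG_contDiff : ContDiff ℝ 1 bumpG := by
  unfold bumpG
  have : ContDiff ℝ 1 (fun w : ℂ => Complex.normSq w) := by
    simp only [Complex.normSq_apply]
    exact (Complex.reCLM.contDiff.mul Complex.reCLM.contDiff).add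
      (Complex.imCLM.contDiff.mul Complex.imCLM.contDiff)
  exact Complex.ofRealCLM.contDiff.comp (bumpE_contDiff.comp this)

theorem bumpG_compact : HasCompactSupport bumpG := by
  apply HasCompactSupport.of_support_subset_isCompact (isCompact_closedBall (0:ℂ) 2)
  intro w hw
  by_contra h
  apply hw
  simp only [mem_closedBall, dist_zero_right, not_le] at h
  unfold bumpG bumpE
  rw [Real.smoothTransition.zero_of_nonpos]; · simp
  rw [Complex.normSq_eq_norm_sq]; nlinarith

theorem bumpG_near : ∀ᶠ w in 𝓝 (0:ℂ), bumpG w = 1 := by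
  filter_upwards [Metric.ball_mem_nhds (0:ℂ) one_pos] with w hw
  simp only [mem_ball, dist_zero_right] at hw
  unfold bumpG bumpE
  rw [Real.smoothTransition.one_of_one_le]; · simp
  rw [Complex.normSq_eq_norm_sq]; nlinarith [norm_nonneg w]

theorem dbar_bumpG (w : ℂ) : dbar bumpG w = 2 * ((deriv bumpE (Complex.normSq w) : ℝ) : ℂ) * w := by
  have h1 : HasDerivAt bumpE (deriv bumpE (Complex.normSq w)) (Complex.normSq w) :=
    (bumpE_contDiff.differentiable (by norm_num) _).hasDerivAt
  have h2 := h1.hasFDerivAt.comp w (normSq_hasFDerivAt w)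
  have h3 := Complex.ofRealCLM.hasFDerivAt.comp w h2
  have h4 : fderiv ℝ bumpG w = _ := h3.fderiv
  unfold dbar
  rw [h4]
  simp
  linear_combination (2 * ((deriv bumpE (Complex.normSq w) : ℝ) : ℂ)) * Complex.re_add_im w

theorem bumpE_deriv_nonpos (t : ℝ) : deriv bumpE t ≤ 0 := by
  have : Antitone bumpE := by
    intro a b hab
    exact Real.smoothTransition.monotone (by linarith)
  exact this.deriv_nonpos

theorem bump_integral : ∫ w, dbar bumpG w * w⁻¹ ≠ 0 := by
  have hcont : Continuous (fun w : ℂ => -2 * deriv bumpE (Complex.normSq w)) :=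
    continuous_const.mul ((bumpE_contDiff.continuous_deriv (by norm_num)).comp Complex.continuous_normSq)
  have hd0 : ∀ t : ℝ, t < 1 ∨ 2 < t → deriv bumpE t = 0 := by
    rintro t (h | h)
    · have : bumpE =ᶠ[𝓝 t] fun _ => 1 := by
        filter_upwards [Iio_mem_nhds h] with x hx
        exact Real.smoothTransition.one_of_one_le (by simp at hx; linarith)
      simp [this.deriv_eq]
    · have : bumpE =ᶠ[𝓝 t] fun _ => 0 := by
        filter_upwards [Ioi_mem_nhds h] with x hx
        exact Real.smoothTransition.zero_of_nonpos (by simp at hx; linarith)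
      simp [this.deriv_eq]
  have hcs : HasCompactSupport (fun w : ℂ => -2 * deriv bumpE (Complex.normSq w)) := by
    apply HasCompactSupport.of_support_subset_isCompact (isCompact_closedBall (0:ℂ) 2)
    intro w hw
    by_contra h
    apply hw
    simp only [mem_closedBall, dist_zero_right, not_le] at h
    show -2 * deriv bumpE (Complex.normSq w) = 0
    rw [hd0]; · simp
    right
    rw [Complex.normSq_eq_norm_sq]; nlinarith
  obtain ⟨t, ht⟩ : ∃ t, deriv bumpE t ≠ 0 := by
    by_contra! hcon
    have := is_const_of_deriv_eq_zero (bumpE_contDiff.differentiable (by norm_num)) hcon 0 3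
    simp only [bumpE] at this
    rw [Real.smoothTransition.one_of_one_le (by norm_num), Real.smoothTransition.zero_of_nonpos (by norm_num)] at this
    norm_num at this
  have ht1 : 1 ≤ t := by
    by_contra! h
    exact ht (hd0 t (Or.inl h))
  have hpos := hcont.integral_pos_of_hasCompactSupport_nonneg_nonzero (μ := MeasureTheory.volume) hcs
    (fun w => by have := bumpE_deriv_nonpos (Complex.normSq w); simp only [Pi.zero_apply]; linarith)
    (x := ((Real.sqrt t : ℝ) : ℂ)) (by
      simp [Complex.normSq_ofReal, Real.mul_self_sqrt (by linarith : 0 ≤ t), ht])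
  have heq : (fun w => dbar bumpG w * w⁻¹) =
      fun w => -(((-2 * deriv bumpE (Complex.normSq w) : ℝ)) : ℂ) := by
    ext w
    by_cases hw : w = 0
    · subst hw
      rw [hd0 _ (by simp)]; simp
    · rw [dbar_bumpG]; field_simp; push_cast; ring
  rw [heq, MeasureTheory.integral_neg, integral_complex_ofReal]
  intro h
  have : (∫ w : ℂ, -2 * deriv bumpE (Complex.normSq w)) = 0 := by
    exact_mod_cast neg_eq_zero.mp h
  linarith

/-- the Cauchy transform of dbar psi -/
theorem cauchy_one (ψ : ℂ → ℂ) (hf : ContDiff ℝ 1 ψ) (hc : HasCompactSupport ψ) (z : ℂ)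
    (hz : ∀ᶠ w in 𝓝 z, ψ w = 1) (hint : MeasureTheory.Integrable (fun w => dbar ψ w * (w - z)⁻¹)) :
    ∫ w, dbar ψ w * (w - z)⁻¹ = ∫ w, dbar bumpG w * w⁻¹ := by
  have hsub : ContDiff ℝ 1 (fun w : ℂ => w - z) := contDiff_id.sub contDiff_const
  have hG : ContDiff ℝ 1 (fun w => bumpG (w - z)) := bumpG_contDiff.comp hsub
  have hGc : HasCompactSupport (fun w => bumpG (w - z)) := 
    bumpG_compact.comp_homeomorph (Homeomorph.subRight z)
  have hdb : ∀ w, dbar (fun w => bumpG (w - z)) w = dbar bumpG (w - z) := by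
    intro w
    unfold dbar
    rw [fderiv_comp_sub]
  have h0 := integral_dbar_mul_inv_zero (fun w => ψ w - bumpG (w - z)) (hf.sub hG) 
    (by
      exact hc.sub hGc) z (by
      have ht : Tendsto (fun w : ℂ => w - z) (𝓝 z) (𝓝 0) := by
        have : Continuous (fun w : ℂ => w - z) := by fun_prop
        simpa using this.tendsto z
      filter_upwards [hz, ht.eventually bumpG_near] with w h1 h2
      simp [h1, h2])
  have hd : ∀ w, dbar (fun w => ψ w - bumpG (w - z)) w * (w - z)⁻¹ =
      dbar ψ w * (w - z)⁻¹ - dbar bumpG (w - z) * (w - z)⁻¹ := by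
    intro w
    rw [← hdb w]
    unfold dbar
    rw [fderiv_fun_sub (hf.differentiable (by norm_num) w) (hG.differentiable (by norm_num) w)]
    simp; ring
  have hint2 : MeasureTheory.Integrable (fun w => dbar bumpG w * w⁻¹) := by
    by_contra hcon
    exact bump_integral (MeasureTheory.integral_undef hcon)
  simp_rw [hd] at h0
  rw [MeasureTheory.integral_sub hint (hint2.comp_sub_right z), sub_eq_zero] at h0
  rw [h0]
  exact MeasureTheory.integral_sub_right_eq_self (fun w => dbar bumpG w * w⁻¹) z

open scoped Manifold ContDiff

theorem exists_cutoff (A B : Set ℂ) (hA : IsCompact A) (hB : IsClosed B) (hAB : Disjoint A B) :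
    ∃ ψ : ℂ → ℂ, ContDiff ℝ 1 ψ ∧ HasCompactSupport ψ ∧ (∀ z ∈ A, ∀ᶠ w in 𝓝 z, ψ w = 1) ∧
      (∀ z ∈ B, ∀ᶠ w in 𝓝 z, ψ w = 0) := by
  obtain ⟨δ, hδ, hsub⟩ := hA.exists_cthickening_subset_open hB.isOpen_compl
    (Set.subset_compl_iff_disjoint_right.mpr hAB)
  have hint : A ⊆ interior (cthickening δ A) :=
    (self_subset_thickening hδ A).trans (thickening_subset_interior_cthickening δ A)
  obtain ⟨f, h1, h2, h3⟩ := exists_contMDiffMap_one_nhds_of_subset_interior (n := 1) 𝓘(ℝ, ℂ)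
    hA.isClosed hint
  refine ⟨fun w => (f w : ℂ), ?_, ?_, ?_, ?_⟩
  · have : ContDiff ℝ 1 f := f.contMDiff.contDiff
    exact Complex.ofRealCLM.contDiff.comp this
  · apply HasCompactSupport.of_support_subset_isCompact (hA.cthickening (r := δ))
    intro w hw
    by_contra h
    apply hw
    simp [h2 w h]
  · intro z hz
    rw [eventually_nhdsSet_iff_forall] at h1
    filter_upwards [h1 z hz] with w hw
    simp [hw]
  · intro z hz
    have : z ∈ (cthickening δ A)ᶜ := fun h => hsub h hz
    filter_upwards [isClosed_cthickening.isOpen_compl.mem_nhds this] with w hw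
    simp [h2 w hw]

theorem runge_idem (A B : Set ℂ) (hA : IsCompact A) (hB : IsCompact B) (hAB : Disjoint A B)
    (hconn : IsPreconnected (A ∪ B)ᶜ) (s : ℝ) (hs : 0 < s) :
    ∃ p : Polynomial ℂ, (∀ z ∈ A, ‖p.eval z - 1‖ ≤ s) ∧ (∀ z ∈ B, ‖p.eval z‖ ≤ s) := by
  obtain ⟨ψ, hψ, hψc, hψA, hψB⟩ := exists_cutoff A B hA hB.isClosed hAB
  set L : Set ℂ := A ∪ B with hLdef
  have hL : IsCompact L := hA.union hB
  haveI : CompactSpace L := isCompact_iff_compactSpace.mp hL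
  let x : C(L, ℂ) := ⟨Subtype.val, continuous_subtype_val⟩
  let S : Subalgebra ℂ C(L, ℂ) := (Algebra.adjoin ℂ {x}).topologicalClosure
  haveI hSc : IsClosed (S : Set C(L, ℂ)) := Subalgebra.isClosed_topologicalClosure _
  haveI : CompleteSpace S := hSc.completeSpace_coe
  have hxS : x ∈ S := Subalgebra.le_topologicalClosure _ (Algebra.self_mem_adjoin_singleton ℂ x)
  let y : S := ⟨x, hxS⟩
  have hspx : spectrum ℂ x = L := by
    rw [ContinuousMap.spectrum_eq_range]
    exact Subtype.range_val
  have hsp : spectrum ℂ y = L := by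
    refine Eq.trans ?_ hspx
    apply Subalgebra.spectrum_eq_of_isPreconnected_compl S y
    show IsPreconnected (spectrum ℂ x)ᶜ
    rw [hspx]; exact hconn
  let F : ℂ → S := fun w => dbar ψ w • resolvent y w
  have hd0 : ∀ w ∈ L, ∀ᶠ v in 𝓝 w, dbar ψ v = 0 := by
    rintro w (hw | hw)
    · filter_upwards [(hψA w hw).eventually_nhds] with v hv
      exact dbar_eventually_const hv
    · filter_upwards [(hψB w hw).eventually_nhds] with v hv
      exact dbar_eventually_const hv
  have hFc : Continuous F := by
    rw [continuous_iff_continuousAt]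
    intro w
    by_cases hw : w ∈ L
    · have : F =ᶠ[𝓝 w] fun _ => 0 := by
        filter_upwards [hd0 w hw] with v hv
        simp [F, hv]
      exact continuousAt_const.congr this.symm
    · have hres : w ∈ resolventSet ℂ y := by
        have : w ∉ spectrum ℂ y := by rw [hsp]; exact hw
        exact not_not.mp this
      exact (dbar_continuous hψ).continuousAt.smul (spectrum.hasDerivAt_resolvent hres).continuousAt
  have hFs : HasCompactSupport F := (dbar_hasCompactSupport hψc).smul_right
  have hFi : MeasureTheory.Integrable F := hFc.integrable_of_hasCompactSupport hFs
  let b : S := ∫ w, F w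
  have hev : ∀ z : L, MeasureTheory.Integrable (fun w => dbar ψ w * (w - z)⁻¹) ∧
      (b : C(L, ℂ)) z = ∫ w, dbar ψ w * (w - z)⁻¹ := by
    intro z
    let ev : S →L[ℂ] ℂ := (ContinuousMap.evalCLM ℂ z).comp (S.toSubmodule.subtypeL)
    have hevF : ∀ w, ev (F w) = dbar ψ w * (w - z)⁻¹ := by
      intro w
      by_cases hw : w ∈ L
      · have : dbar ψ w = 0 := (hd0 w hw).self_of_nhds
        simp [F, this]
      · have hres : IsUnit (algebraMap ℂ S w - y) := by
          have : w ∉ spectrum ℂ y := by rw [hsp]; exact hw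
          exact not_not.mp this
        have hmul : (algebraMap ℂ S w - y) * resolvent y w = 1 := Ring.mul_inverse_cancel _ hres
        have h2 := congrArg (fun u : S => (u : C(L, ℂ)) z) hmul
        have h3 : (w - z) * ((resolvent y w : S) : C(L, ℂ)) z = 1 := h2
        have h4 : ((resolvent y w : S) : C(L, ℂ)) z = (w - z)⁻¹ := eq_inv_of_mul_eq_one_right h3
        rw [← h4]
        rfl
    have h1 := ev.integral_comp_comm hFi
    have h2 := ev.integrable_comp hFi
    simp_rw [hevF] at h1 h2
    exact ⟨h2, h1.symm⟩
  set c : ℂ := ∫ w, dbar bumpG w * w⁻¹ with hc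
  have hc0 : c ≠ 0 := bump_integral
  have hb1 : ∀ z : L, (z:ℂ) ∈ A → (b : C(L, ℂ)) z = c := by
    intro z hz
    rw [(hev z).2]
    exact cauchy_one ψ hψ hψc z (hψA z hz) (hev z).1
  have hb0 : ∀ z : L, (z:ℂ) ∈ B → (b : C(L, ℂ)) z = 0 := by
    intro z hz
    rw [(hev z).2]
    exact integral_dbar_mul_inv_zero ψ hψ hψc z (hψB z hz)
  let e : S := c⁻¹ • b
  have heS : (e : C(L, ℂ)) ∈ closure ((Algebra.adjoin ℂ {x} : Subalgebra ℂ C(L, ℂ)) : Set C(L, ℂ)) := by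
    have := e.2
    rw [← Subalgebra.topologicalClosure_coe]
    exact this
  obtain ⟨u, hu, hdu⟩ := Metric.mem_closure_iff.mp heS s hs
  have hu' : u ∈ Algebra.adjoin ℂ {x} := hu
  rw [Algebra.adjoin_singleton_eq_range_aeval] at hu'
  obtain ⟨p, hp⟩ := hu'
  have hpz : ∀ z : L, u z = p.eval (z:ℂ) := by
    intro z
    rw [← hp]
    have := Polynomial.aeval_algHom_apply (ContinuousMap.evalAlgHom ℂ ℂ z) x p
    have h2 : (ContinuousMap.evalAlgHom ℂ ℂ z) x = (z:ℂ) := rfl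
    rw [h2] at this
    rw [← Polynomial.coe_aeval_eq_eval]
    exact this.symm
  have hle : ∀ z : L, ‖p.eval (z:ℂ) - c⁻¹ * (b : C(L, ℂ)) z‖ ≤ s := by
    intro z
    have h1 := ContinuousMap.dist_apply_le_dist (f := (e : C(L, ℂ))) (g := u) z
    rw [dist_comm, dist_eq_norm, hpz] at h1
    exact h1.trans hdu.le
  refine ⟨p, ?_, ?_⟩
  · intro z hz
    have := hle ⟨z, Or.inl hz⟩
    rw [hb1 _ hz, inv_mul_cancel₀ hc0] at this
    exact this
  · intro z hz
    have := hle ⟨z, Or.inr hz⟩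
    rw [hb0 _ hz] at this
    simpa using this

theorem binom_tail (a b : ℂ) (n : ℕ) (ha : ‖a‖ ≤ 1/100) (hb : ‖b‖ ≤ 101/100) :
    ‖∑ k ∈ Finset.range (n+1), ((2*n+1).choose k : ℂ) * b^k * a^(2*n+1-k)‖ ≤ (1/16:ℝ)^n := by
  have h1 : ∀ k ∈ Finset.range (n+1), ‖((2*n+1).choose k : ℂ) * b^k * a^(2*n+1-k)‖ ≤
      ((2*n+1).choose k : ℝ) * ((1/100)^(n+1) * (101/100)^(2*n+1)) := by
    intro k hk
    rw [Finset.mem_range] at hk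
    rw [norm_mul, norm_mul, norm_pow, norm_pow, Complex.norm_natCast, mul_assoc]
    apply mul_le_mul_of_nonneg_left _ (Nat.cast_nonneg _)
    rw [mul_comm]
    apply mul_le_mul
    · calc ‖a‖^(2*n+1-k) ≤ (1/100)^(2*n+1-k) := pow_le_pow_left₀ (norm_nonneg _) ha _
        _ ≤ (1/100:ℝ)^(n+1) := pow_le_pow_of_le_one (by norm_num) (by norm_num) (by omega)
    · calc ‖b‖^k ≤ (101/100)^k := pow_le_pow_left₀ (norm_nonneg _) hb _
        _ ≤ (101/100:ℝ)^(2*n+1) := pow_le_pow_right₀ (by norm_num) (by omega)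
    · positivity
    · positivity
  refine (norm_sum_le _ _).trans ((Finset.sum_le_sum h1).trans ?_)
  rw [← Finset.sum_mul]
  have h2 : ∑ k ∈ Finset.range (n+1), ((2*n+1).choose k : ℝ) = 4^n := by
    exact_mod_cast Nat.sum_range_choose_halfway n
  rw [h2]
  have h3 : (4:ℝ)^n * ((1/100)^(n+1) * (101/100)^(2*n+1)) = (4 * (1/100) * (101/100)^2)^n * (1/100*(101/100)) := by
    rw [mul_pow, mul_pow, ← pow_mul]; ring
  rw [h3]
  calc (4 * (1/100) * (101/100)^2 : ℝ)^n * (1/100*(101/100)) ≤ (4 * (1/100) * (101/100)^2 : ℝ)^n * 1 := by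
        apply mul_le_mul_of_nonneg_left (by norm_num) (by positivity)
    _ ≤ (1/16)^n := by
        rw [mul_one]
        exact pow_le_pow_left₀ (by norm_num) (by norm_num) _

theorem binom_split (a b : ℂ) (n : ℕ) (hab : b + a = 1) :
    (∑ k ∈ Finset.range (n+1), ((2*n+1).choose k : ℂ) * b^k * a^(2*n+1-k)) +
    (∑ k ∈ Finset.range (n+1), ((2*n+1).choose k : ℂ) * a^k * b^(2*n+1-k)) = 1 := by
  have h := add_pow b a (2*n+1)
  rw [hab, one_pow, show 2*n+1+1 = (n+1)+(n+1) by ring, Finset.sum_range_add] at h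
  rw [h]
  congr 1
  · apply Finset.sum_congr rfl; intros; ring
  · rw [← Finset.sum_range_reflect]
    apply Finset.sum_congr rfl
    intro k hk
    rw [Finset.mem_range] at hk
    have e1 : n + 1 - 1 - k = n - k := by omega
    have e2 : 2*n+1 - (n-k) = n+1+k := by omega
    have e3 : 2*n+1-(n+1+k) = n - k := by omega
    rw [e1, e2, e3]
    have : (2*n+1).choose (n-k) = (2*n+1).choose (n+1+k) := by
      apply Nat.choose_symm_of_eq_add; omega
    rw [this]; ring

theorem apn_idem (A B : Set ℂ) (hA : IsCompact A) (hB : IsCompact B) (hAB : Disjoint A B)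
    (hconn : IsPreconnected (A ∪ B)ᶜ) (χ : ℂ → ℂ) (hχA : ∀ z ∈ A, χ z = 1) (hχB : ∀ z ∈ B, χ z = 0) :
    ∃ r : ℝ, 0 < r ∧ r < 1 ∧ Apn (A ∪ B) r χ := by
  obtain ⟨p, hpA, hpB⟩ := runge_idem A B hA hB hAB hconn (1/100) (by norm_num)
  set d := p.natDegree with hd
  set N := 3 * (d+1) with hN
  have hN0 : N ≠ 0 := by omega
  have hrN : ((1/16:ℝ)^(1/(N:ℝ)))^N = 1/16 := by
    rw [one_div (N:ℝ)]
    exact Real.rpow_inv_natCast_pow (by norm_num) hN0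
  have h0 : 0 < (1/16:ℝ)^(1/(N:ℝ)) := by positivity
  have h1 : (1/16:ℝ)^(1/(N:ℝ)) < 1 := Real.rpow_lt_one (by norm_num) (by norm_num) (by positivity)
  refine ⟨(1/16:ℝ)^(1/(N:ℝ)), h0, h1, ?_⟩
  apply apn_of_steps h0 h1 N (by omega) 1
  intro k
  rw [hrN, one_mul]
  rcases Nat.eq_zero_or_pos k with rfl | hk
  · refine ⟨0, by simp, ?_⟩
    rintro z (hz | hz)
    · simp [hχA z hz]
    · simp [hχB z hz]
  · refine ⟨∑ j ∈ Finset.range (k+1), Polynomial.C ((2*k+1).choose j : ℂ) * (1-p)^j * p^(2*k+1-j), ?_, ?_⟩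
    · apply Polynomial.natDegree_sum_le_of_forall_le
      intro j hj
      rw [Finset.mem_range] at hj
      have e1 : (1 - p).natDegree ≤ d := by
        refine (Polynomial.natDegree_sub_le _ _).trans ?_
        simp [hd]
      calc _ ≤ (Polynomial.C ((2*k+1).choose j : ℂ) * (1-p)^j).natDegree + (p^(2*k+1-j)).natDegree :=
            Polynomial.natDegree_mul_le
        _ ≤ ((1-p)^j).natDegree + (p^(2*k+1-j)).natDegree := by
            gcongr; exact Polynomial.natDegree_C_mul_le _ _
        _ ≤ j * d + (2*k+1-j) * d := by
            gcongr
            · exact Polynomial.natDegree_pow_le.trans (Nat.mul_le_mul_left _ e1)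
            · exact Polynomial.natDegree_pow_le
        _ = (2*k+1) * d := by rw [← Nat.add_mul]; congr 1; omega
        _ ≤ N * k := by rw [hN]; nlinarith
    · intro z hz
      have hev : Polynomial.eval z (∑ j ∈ Finset.range (k+1), Polynomial.C ((2*k+1).choose j : ℂ) * (1-p)^j * p^(2*k+1-j))
        = ∑ j ∈ Finset.range (k+1), ((2*k+1).choose j : ℂ) * (1-p.eval z)^j * (p.eval z)^(2*k+1-j) := by
        simp [Polynomial.eval_finset_sum]
      rw [hev]
      rcases hz with hz | hz
      · rw [hχA z hz, sub_eq_of_eq_add' (binom_split (p.eval z) (1 - p.eval z) k (by ring)).symm]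
        apply binom_tail
        · rw [norm_sub_rev]; exact hpA z hz
        · calc ‖p.eval z‖ = ‖(p.eval z - 1) + 1‖ := by ring_nf
            _ ≤ ‖p.eval z - 1‖ + ‖(1:ℂ)‖ := norm_add_le _ _
            _ ≤ _ := by rw [norm_one]; linarith [hpA z hz]
      · rw [hχB z hz, zero_sub, norm_neg]
        apply binom_tail
        · exact hpB z hz
        · calc ‖1 - p.eval z‖ ≤ ‖(1:ℂ)‖ + ‖p.eval z‖ := norm_sub_le _ _
            _ ≤ _ := by rw [norm_one]; linarith [hpB z hz]

theorem supNorm_nonneg (g : ℂ → ℂ) (X : Set ℂ) : 0 ≤ supNorm g X := by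
  apply Real.sSup_nonneg
  rintro _ ⟨z, _, rfl⟩
  exact norm_nonneg _

theorem dApprox_nonneg (L : Set ℂ) (G : ℂ → ℂ) (n : ℕ) : 0 ≤ dApprox L G n := by
  apply Real.sInf_nonneg
  rintro _ ⟨p, _, rfl⟩
  exact supNorm_nonneg _ _

theorem dApprox_le {L : Set ℂ} {G : ℂ → ℂ} {n : ℕ} {p : Polynomial ℂ} {M : ℝ} (hp : p.natDegree ≤ n)
    (hM : 0 ≤ M) (h : ∀ z ∈ L, ‖G z - p.eval z‖ ≤ M) : dApprox L G n ≤ M := by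
  have h1 : dApprox L G n ≤ supNorm (fun z => G z - p.eval z) L := by
    apply csInf_le
    · refine ⟨0, ?_⟩
      rintro _ ⟨p, _, rfl⟩
      exact supNorm_nonneg _ _
    · exact ⟨p, Polynomial.natDegree_le_iff_degree_le.mp hp, rfl⟩
  refine h1.trans ?_
  apply Real.sSup_le _ hM
  rintro _ ⟨z, hz, rfl⟩
  exact h z hz

theorem rho_bdd {L : Set ℂ} {G : ℂ → ℂ} {M : ℝ} (hM : ∀ z ∈ L, ‖G z‖ ≤ M) :
    IsBoundedUnder (· ≤ ·) atTop (fun n : ℕ => dApprox L G n ^ (1 / (n : ℝ))) := by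
  refine ⟨max M 1, ?_⟩
  rw [eventually_map]
  filter_upwards [eventually_ge_atTop 1] with n hn
  have h1 : dApprox L G n ≤ max M 1 :=
    dApprox_le (p := 0) (by simp) (by positivity) (fun z hz => by simpa using Or.inl (hM z hz))
  have hn' : (1:ℝ) ≤ n := by exact_mod_cast hn
  calc dApprox L G n ^ (1 / (n : ℝ)) ≤ (max M 1) ^ (1 / (n:ℝ)) :=
        Real.rpow_le_rpow (dApprox_nonneg _ _ _) h1 (by positivity)
    _ ≤ (max M 1) ^ (1:ℝ) := by
        apply Real.rpow_le_rpow_of_exponent_le (le_max_right _ _)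
        rw [div_le_one (by linarith)]; exact hn'
    _ = _ := Real.rpow_one _

theorem rho_nonneg {L : Set ℂ} {G : ℂ → ℂ} {M : ℝ} (hM : ∀ z ∈ L, ‖G z‖ ≤ M) : 0 ≤ rho L G := by
  apply le_limsup_of_frequently_le _ (rho_bdd hM)
  apply Eventually.frequently
  filter_upwards with n
  exact Real.rpow_nonneg (dApprox_nonneg _ _ _) _

theorem rho_le_of_apn {L : Set ℂ} {G : ℂ → ℂ} {r : ℝ} (h0 : 0 < r) (h : Apn L r G) : rho L G ≤ r := by
  obtain ⟨C, hC⟩ := h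
  have hC1 : 0 < max C 1 := by positivity
  have hd : ∀ n, dApprox L G n ≤ max C 1 * r^n := by
    intro n
    obtain ⟨p, hp, hp2⟩ := hC n
    refine dApprox_le hp (by positivity) (fun z hz => (hp2 z hz).trans ?_)
    exact mul_le_mul_of_nonneg_right (le_max_left _ _) (by positivity)
  have hlim : Tendsto (fun n : ℕ => (max C 1) ^ (1/(n:ℝ)) * r) atTop (𝓝 r) := by
    have h1 : Tendsto (fun n : ℕ => 1/(n:ℝ)) atTop (𝓝 0) := tendsto_one_div_atTop_nhds_zero_nat
    have h2 := (Real.continuousAt_const_rpow hC1.ne' (b := 0)).tendsto.comp h1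
    have h3 := h2.mul_const r
    simpa using h3
  have hle : (fun n : ℕ => dApprox L G n ^ (1 / (n : ℝ))) ≤ᶠ[atTop] 
      (fun n : ℕ => (max C 1) ^ (1/(n:ℝ)) * r) := by
    filter_upwards [eventually_ge_atTop 1] with n hn
    calc dApprox L G n ^ (1 / (n : ℝ)) ≤ (max C 1 * r^n) ^ (1/(n:ℝ)) :=
          Real.rpow_le_rpow (dApprox_nonneg _ _ _) (hd n) (by positivity)
      _ = _ := by
          rw [Real.mul_rpow hC1.le (by positivity), one_div,
            Real.pow_rpow_inv_natCast h0.le (by omega)]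
  have := limsup_le_limsup hle (IsCoboundedUnder.of_frequently_ge (a := 0) (by
      apply Eventually.frequently
      filter_upwards with n
      exact Real.rpow_nonneg (dApprox_nonneg _ _ _) _)) hlim.isBoundedUnder_le
  rw [hlim.limsup_eq] at this
  exact this

theorem apn_of_rho_lt {L : Set ℂ} (hL : IsCompact L) {G : ℂ → ℂ} {r M : ℝ} (h0 : 0 < r) (h1 : r < 1)
    (hM : ∀ z ∈ L, ‖G z‖ ≤ M) (h : rho L G < r) : Apn L r G := by
  have hev := eventually_lt_of_limsup_lt h (rho_bdd hM)
  obtain ⟨n0, hn0⟩ := (hev.and (eventually_ge_atTop 1)).exists_forall_of_atTop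
  refine ⟨max 1 (M / r^n0), fun n => ?_⟩
  rcases lt_or_ge n n0 with hn | hn
  · refine ⟨0, by simp, fun z hz => ?_⟩
    simp only [Polynomial.eval_zero, sub_zero]
    have hMz := hM z hz
    have hM0 : 0 ≤ M := (norm_nonneg _).trans hMz
    calc ‖G z‖ ≤ M := hMz
      _ = M / r^n0 * r^n0 := by field_simp
      _ ≤ M / r^n0 * r^n := by
          apply mul_le_mul_of_nonneg_left _ (by positivity)
          exact pow_le_pow_of_le_one h0.le h1.le hn.le
      _ ≤ _ := mul_le_mul_of_nonneg_right (le_max_right _ _) (by positivity)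
  · obtain ⟨hlt, hn1⟩ := hn0 n hn
    have hd : dApprox L G n < r^n := by
      have h2 := pow_lt_pow_left₀ hlt (Real.rpow_nonneg (dApprox_nonneg _ _ _) _) (by omega : n ≠ 0)
      rwa [one_div, Real.rpow_inv_natCast_pow (dApprox_nonneg _ _ _) (by omega)] at h2
    obtain ⟨c, ⟨p, hp, rfl⟩, hc⟩ := exists_lt_of_csInf_lt (by
      exact ⟨_, 0, by simp, rfl⟩) hd
    refine ⟨p, Polynomial.natDegree_le_iff_degree_le.mpr hp, fun z hz => ?_⟩
    have hbd : BddAbove ((fun z => ‖G z - p.eval z‖) '' L) := by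
      obtain ⟨P, hP⟩ := hL.exists_bound_of_continuousOn p.continuous.continuousOn
      refine ⟨M + P, ?_⟩
      rintro _ ⟨w, hw, rfl⟩
      exact (norm_sub_le _ _).trans (add_le_add (hM w hw) (hP w hw))
    calc ‖G z - p.eval z‖ ≤ supNorm (fun z => G z - p.eval z) L := le_csSup hbd ⟨z, hz, rfl⟩
      _ ≤ r^n := hc.le
      _ = 1 * r^n := by ring
      _ ≤ _ := mul_le_mul_of_nonneg_right (le_max_left _ _) (by positivity)

theorem AP_of_rho_le {L : Set ℂ} (hL : IsCompact L) {G : ℂ → ℂ} {r M : ℝ}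
    (hM : ∀ z ∈ L, ‖G z‖ ≤ M) (h : rho L G ≤ r) : AP L r G := by
  intro s hs hs1
  have hs0 : 0 < s := ((rho_nonneg hM).trans h).trans_lt hs
  exact apx_of_apn hs0 hs1 (apn_of_rho_lt hL hs0 hs1 hM (h.trans_lt hs))

theorem rho_le_of_AP {L : Set ℂ} {G : ℂ → ℂ} {r : ℝ} (h0 : 0 ≤ r) (h1 : r < 1) (h : AP L r G) :
    rho L G ≤ r := by
  apply le_of_forall_gt_imp_ge_of_dense
  intro s hs
  rcases lt_or_ge s 1 with hs1 | hs1
  · exact rho_le_of_apn (h0.trans_lt hs) (apn_of_apx (h0.trans_lt hs) hs1 (h s hs hs1))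
  · obtain ⟨t, ht, ht1⟩ := exists_between h1
    exact (rho_le_of_apn (h0.trans_lt ht) (apn_of_apx (h0.trans_lt ht) ht1 (h t ht ht1))).trans
      (by linarith)

section final
variable {m : ℕ} {K : Fin (m + 1) → Set ℂ} {L : Set ℂ}

noncomputable def chi (K : Fin (m + 1) → Set ℂ) (i : Fin (m + 1)) : ℂ → ℂ :=
  Set.indicator (K i) (fun _ => 1)

theorem chi_self {i : Fin (m + 1)} {z : ℂ} (hz : z ∈ K i) : chi K i z = 1 := by
  simp [chi, hz]

theorem chi_ne (hKdisj : ∀ i j, i ≠ j → Disjoint (K i) (K j)) {i j : Fin (m + 1)} (hij : j ≠ i) {z : ℂ}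
    (hz : z ∈ K j) : chi K i z = 0 := by
  have : z ∉ K i := Set.disjoint_left.mp (hKdisj j i hij) hz
  simp [chi, this]

theorem chi_rest (hKc : ∀ i, IsCompact (K i)) (hKdisj : ∀ i j, i ≠ j → Disjoint (K i) (K j))
    (hL : L = ⋃ i, K i) (i : Fin (m + 1)) :
    ∃ B : Set ℂ, IsCompact B ∧ Disjoint (K i) B ∧ L = K i ∪ B ∧ ∀ z ∈ B, chi K i z = 0 := by
  refine ⟨⋃ j ∈ ({i}ᶜ : Finset (Fin (m+1))), K j, ?_, ?_, ?_, ?_⟩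
  · exact Finset.isCompact_biUnion _ (fun j _ => hKc j)
  · rw [Set.disjoint_iUnion₂_right]
    intro j hj
    exact hKdisj i j (by simp at hj; exact fun h => hj h.symm)
  · rw [hL]
    ext z
    simp only [Set.mem_iUnion, Set.mem_union, Finset.mem_compl, Finset.mem_singleton, exists_prop]
    constructor
    · rintro ⟨j, hj⟩
      by_cases h : j = i
      · left; rwa [← h]
      · right; exact ⟨j, h, hj⟩
    · rintro (h | ⟨j, _, h⟩)
      · exact ⟨i, h⟩
      · exact ⟨j, h⟩
  · intro z hz
    simp only [Set.mem_iUnion, Finset.mem_compl, Finset.mem_singleton, exists_prop] at hz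
    obtain ⟨j, hj, hz⟩ := hz
    exact chi_ne hKdisj hj hz

theorem chi_good (hKc : ∀ i, IsCompact (K i)) (hKconn : ∀ i, IsConnected (K i))
    (hKdisj : ∀ i j, i ≠ j → Disjoint (K i) (K j)) (hnt : ∀ i, (K i).Nontrivial)
    (hL : L = ⋃ i, K i) (i : Fin (m + 1)) : Good L (chi K i) := by
  constructor
  · intro z hz
    by_cases h : z ∈ K i
    · simp [chi, h]
    · simp [chi, h]
  · intro a ha
    have ha' := ha
    rw [hL, Set.mem_iUnion] at ha'
    obtain ⟨j, hj⟩ := ha'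
    refine ⟨K j, ?_, (hKconn j).isPreconnected, hnt j, hj, ?_, ?_⟩
    · rw [hL]; exact Set.subset_iUnion K j
    · obtain ⟨B, hB, hd, hLB, _⟩ := chi_rest hKc hKdisj hL j
      have : a ∈ Bᶜ := fun h => Set.disjoint_left.mp hd hj h
      obtain ⟨ρ, hρ, hball⟩ := Metric.isOpen_iff.mp hB.isClosed.isOpen_compl a this
      refine ⟨ρ, hρ, fun z hz hza => ?_⟩
      have hzB : z ∈ Bᶜ := hball (by rwa [mem_ball, dist_eq_norm])
      rw [hLB] at hz
      exact hz.resolve_right hzB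
    · by_cases hij : j = i
      · subst hij
        exact ⟨1, fun z hz => chi_self hz⟩
      · exact ⟨0, fun z hz => chi_ne hKdisj hij hz⟩

theorem AP_chi (hKc : ∀ i, IsCompact (K i)) (hKconn : ∀ i, IsConnected (K i))
    (hKdisj : ∀ i j, i ≠ j → Disjoint (K i) (K j)) (hnt : ∀ i, (K i).Nontrivial)
    (hL : L = ⋃ i, K i) (hLc : IsCompact L) (hLne : L.Nonempty) {r : ℝ} (h0 : 0 ≤ r)
    (G : ℂ → ℂ) (q : Fin (m + 1) → Polynomial ℂ)
    (hq : ∀ i j, i ≠ j → q i ≠ q j) (hG : ∀ i, ∀ z ∈ K i, G z = (q i).eval z)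
    (hAP : AP L r G) (i : Fin (m + 1)) : AP L r (chi K i) := by
  have hprod : AP L r (fun z => ∏ j ∈ ({i}ᶜ : Finset (Fin (m+1))), (G z + (-(q j)).eval z)) :=
    AP.prod hLc h0 _ _ (fun j _ => AP.add hAP (AP.poly hLc h0 _))
  refine AP.div_poly hLc hLne h0 (chi K i) (chi_good hKc hKconn hKdisj hnt hL i) _
    (∏ j ∈ ({i}ᶜ : Finset (Fin (m+1))), (q i - q j)) rfl ?_ ?_
  · rw [Finset.prod_ne_zero_iff]
    intro j hj
    simp at hj
    exact sub_ne_zero.mpr (hq i j (fun h => hj h.symm))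
  · refine AP.congr (fun z hz => ?_) hprod
    rw [hL, Set.mem_iUnion] at hz
    obtain ⟨k, hk⟩ := hz
    by_cases hki : k = i
    · subst hki
      rw [chi_self hk, mul_one, Polynomial.eval_prod]
      apply Finset.prod_congr rfl
      intro j _
      rw [hG k z hk]; simp [sub_eq_add_neg]
    · rw [chi_ne hKdisj hki hk, mul_zero]
      apply Finset.prod_eq_zero (i := k) (by simpa using hki)
      rw [hG k z hk]; simp

theorem AP_of_chi (hKdisj : ∀ i j, i ≠ j → Disjoint (K i) (K j))
    (hL : L = ⋃ i, K i) (hLc : IsCompact L) {r : ℝ} (h0 : 0 ≤ r)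
    (G : ℂ → ℂ) (q : Fin (m + 1) → Polynomial ℂ) (hG : ∀ i, ∀ z ∈ K i, G z = (q i).eval z)
    (hAP : ∀ i, AP L r (chi K i)) : AP L r G := by
  have h := AP.sum hLc h0 Finset.univ (fun i z => (q i).eval z * chi K i z)
    (fun i _ => AP.mul h0 (AP.poly hLc h0 _) (hAP i))
  refine AP.congr (fun z hz => ?_) h
  rw [hL, Set.mem_iUnion] at hz
  obtain ⟨k, hk⟩ := hz
  rw [Finset.sum_eq_single k]
  · rw [chi_self hk, hG k z hk, mul_one]
  · intro j _ hj
    rw [chi_ne hKdisj hj.symm hk, mul_zero]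
  · simp

theorem exists_rate (hKc : ∀ i, IsCompact (K i))
    (hKdisj : ∀ i j, i ≠ j → Disjoint (K i) (K j))
    (hL : L = ⋃ i, K i) (hLcc : IsConnected Lᶜ) :
    ∃ r : ℝ, 0 ≤ r ∧ r < 1 ∧ ∀ i, AP L r (chi K i) := by
  have h : ∀ i, ∃ r : ℝ, 0 < r ∧ r < 1 ∧ Apn L r (chi K i) := by
    intro i
    obtain ⟨B, hB, hd, hLB, h0⟩ := chi_rest hKc hKdisj hL i
    have := hLcc.isPreconnected
    rw [hLB] at this ⊢
    exact apn_idem (K i) B (hKc i) hB hd this _ (fun z hz => chi_self hz) h0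
  choose r hr0 hr1 hr using h
  refine ⟨Finset.univ.sup' Finset.univ_nonempty r, ?_, ?_, ?_⟩
  · exact (hr0 0).le.trans (Finset.le_sup' r (Finset.mem_univ 0))
  · rw [Finset.sup'_lt_iff]
    exact fun i _ => hr1 i
  · intro i s hs hs1
    have hrs : r i < s := lt_of_le_of_lt (Finset.le_sup' r (Finset.mem_univ i)) hs
    apply apx_of_apn ((hr0 i).trans hrs) hs1
    obtain ⟨C, hC⟩ := hr i
    refine ⟨max C 1, fun n => ?_⟩
    obtain ⟨p, hp, hp2⟩ := hC n
    refine ⟨p, hp, fun z hz => (hp2 z hz).trans ?_⟩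
    exact mul_le_mul (le_max_left _ _) (pow_le_pow_left₀ (hr0 i).le hrs.le n)
      (pow_nonneg (hr0 i).le n) (by positivity)

theorem not_AP_zero (hKc : ∀ i, IsCompact (K i)) (hm : 1 ≤ m) (hKconn : ∀ i, IsConnected (K i))
    (hKdisj : ∀ i j, i ≠ j → Disjoint (K i) (K j)) (hnt : ∀ i, (K i).Nontrivial)
    (hL : L = ⋃ i, K i) (hLc : IsCompact L) (hAP : AP L 0 (chi K 0)) : False := by
  obtain ⟨ρ, hρ⟩ := hLc.isBounded.exists_norm_le
  obtain ⟨B, hB1, hB⟩ := bernstein_walsh_ball (K 0) (hKconn 0).isPreconnected (hnt 0) ρ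
  have hK0L : K 0 ⊆ L := by rw [hL]; exact Set.subset_iUnion K 0
  set r : ℝ := 1 / (2*B) with hr
  have hr0 : 0 < r := by positivity
  have hrB : r * B = 1/2 := by rw [hr]; field_simp
  have hr1 : r < 1 := by nlinarith
  obtain ⟨δ, C, hδ, hC, hs⟩ := hAP r hr0 hr1
  have hchar : ∀ a : ℂ, ‖a‖ ≤ ρ → _ := fun a ha =>
    char_lemma (a := a) hLc hr0 hr1 δ (chi K 0) hδ hC hs hB1 (by rw [hrB]; norm_num)
      (fun n Q M hQ hM => hB n Q M hQ (fun z hz => hM z (hK0L hz)) a ha) 1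
      (fun z hz => by rw [(chi_good hKc hKconn hKdisj hnt hL 0).1 z hz]; simp)
  choose! F hF using hchar
  have hunif : TendstoUniformlyOn (fun n a => ∑ j ∈ Finset.range n, (δ j).eval a) F atTop (closedBall 0 ρ) := by
    rw [Metric.tendstoUniformlyOn_iff]
    intro ε hε
    have hlim : Tendsto (fun n : ℕ => C * (r*B)^n / (1 - r*B)) atTop (𝓝 0) := by
      have := tendsto_pow_atTop_nhds_zero_of_lt_one (r := r * B) (by positivity) (by rw [hrB]; norm_num)
      simpa using (this.const_mul C).div_const (1 - r*B)
    filter_upwards [hlim.eventually (gt_mem_nhds hε)] with n hn a ha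
    rw [dist_comm, dist_eq_norm]
    exact ((hF a (by simpa using ha)).2.2 n).trans_lt hn
  have hcont : ContinuousOn F (closedBall 0 ρ) := by
    apply hunif.continuousOn
    apply Eventually.frequently
    filter_upwards with n
    exact (continuous_finset_sum _ (fun j _ => (δ j).continuous)).continuousOn
  have hFL : ∀ z ∈ L, F z = chi K 0 z := fun z hz => (hF z (hρ z hz)).1.unique (hs z hz)
  have hpre : IsPreconnected (F '' closedBall 0 ρ) :=
    (convex_closedBall (0:ℂ) ρ).isPreconnected.image F hcont
  obtain ⟨z0, hz0⟩ := (hKconn 0).nonempty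
  have h10 : (⟨1, by omega⟩ : Fin (m+1)) ≠ 0 := by
    intro h; simpa using congrArg Fin.val h
  obtain ⟨z1, hz1⟩ := (hKconn ⟨1, by omega⟩).nonempty
  have hz0L : z0 ∈ L := hK0L hz0
  have hz1L : z1 ∈ L := by rw [hL]; exact Set.mem_iUnion.mpr ⟨_, hz1⟩
  have hfin : (F '' closedBall 0 ρ) ⊆ {0, 1} := by
    rintro _ ⟨a, ha, rfl⟩
    have h2 := (hF a (by simpa using ha)).2.1
    simp only [Polynomial.eval_one, one_mul] at h2
    have : F a * (F a - 1) = 0 := by linear_combination h2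
    rcases mul_eq_zero.mp this with h | h
    · left; exact h
    · right; exact sub_eq_zero.mp h
  have hsub : (F '' closedBall 0 ρ).Subsingleton :=
    (Set.toFinite ({0, 1} : Set ℂ)).countable.isTotallyDisconnected _ hfin hpre
  have e := hsub ⟨z0, by simpa using hρ z0 hz0L, rfl⟩ ⟨z1, by simpa using hρ z1 hz1L, rfl⟩
  rw [hFL z0 hz0L, hFL z1 hz1L, chi_self hz0, chi_ne hKdisj h10 hz1] at e
  exact one_ne_zero e

end final

/-- Theorem 2.1: for any function `G` equal, on each connected component `K i` of `L`, to a
polynomial `q i`, the polynomials being pairwise distinct, the quantity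
`limsup_n d_n(G)^{1/n}` lies in `(0,1)` and does not depend on `G`. -/
theorem stmt2 (m₀ : ℕ) (hm : 1 ≤ m₀) (K : Fin (m₀ + 1) → Set ℂ)
    (hKc : ∀ i, IsCompact (K i)) (hKconn : ∀ i, IsConnected (K i))
    (hKdisj : ∀ i j, i ≠ j → Disjoint (K i) (K j))
    (hK0 : (interior (K 0)).Nonempty) (hKnt : ∀ i, i ≠ 0 → (K i).Nontrivial)
    (L : Set ℂ) (hL : L = ⋃ i, K i) (hLcc : IsConnected Lᶜ)
    (G₁ G₂ : ℂ → ℂ) (q₁ q₂ : Fin (m₀ + 1) → Polynomial ℂ)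
    (hq₁ : ∀ i j, i ≠ j → q₁ i ≠ q₁ j) (hq₂ : ∀ i j, i ≠ j → q₂ i ≠ q₂ j)
    (hG₁ : ∀ i, ∀ z ∈ K i, G₁ z = Polynomial.eval z (q₁ i))
    (hG₂ : ∀ i, ∀ z ∈ K i, G₂ z = Polynomial.eval z (q₂ i)) :
    rho L G₁ ∈ Set.Ioo (0:ℝ) 1 ∧ rho L G₁ = rho L G₂ := by
  have hnt : ∀ i, (K i).Nontrivial := by
    intro i
    by_cases hi : i = 0
    · subst hi
      obtain ⟨x, hx⟩ := hK0
      exact (infinite_of_mem_nhds x (mem_interior_iff_mem_nhds.mp hx)).nontrivial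
    · exact hKnt i hi
  have hLc : IsCompact L := by
    rw [hL]; exact isCompact_iUnion hKc
  have hLne : L.Nonempty := by
    obtain ⟨z, hz⟩ := (hKconn 0).nonempty
    exact ⟨z, by rw [hL]; exact Set.mem_iUnion.mpr ⟨0, hz⟩⟩
  have hbdd : ∀ (G : ℂ → ℂ) (q : Fin (m₀ + 1) → Polynomial ℂ),
      (∀ i, ∀ z ∈ K i, G z = Polynomial.eval z (q i)) → ∃ M : ℝ, ∀ z ∈ L, ‖G z‖ ≤ M := by
    intro G q hG
    have h : ∀ i, ∃ M : ℝ, ∀ z ∈ K i, ‖(q i).eval z‖ ≤ M := fun i =>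
      (hKc i).exists_bound_of_continuousOn (q i).continuous.continuousOn
    choose M hM using h
    refine ⟨Finset.univ.sup' Finset.univ_nonempty M, fun z hz => ?_⟩
    rw [hL, Set.mem_iUnion] at hz
    obtain ⟨i, hi⟩ := hz
    rw [hG i z hi]
    exact (hM i z hi).trans (Finset.le_sup' M (Finset.mem_univ i))
  obtain ⟨M₁, hM₁⟩ := hbdd G₁ q₁ hG₁
  obtain ⟨M₂, hM₂⟩ := hbdd G₂ q₂ hG₂
  obtain ⟨r, hr0, hr1, hr⟩ := exists_rate hKc hKdisj hL hLcc
  have hlt₁ : rho L G₁ < 1 :=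
    (rho_le_of_AP hr0 hr1 (AP_of_chi hKdisj hL hLc hr0 G₁ q₁ hG₁ hr)).trans_lt hr1
  have hlt₂ : rho L G₂ < 1 :=
    (rho_le_of_AP hr0 hr1 (AP_of_chi hKdisj hL hLc hr0 G₂ q₂ hG₂ hr)).trans_lt hr1
  have hn₁ := rho_nonneg hM₁
  have hn₂ := rho_nonneg hM₂
  have hχ₁ := AP_chi hKc hKconn hKdisj hnt hL hLc hLne hn₁ G₁ q₁ hq₁ hG₁ (AP_of_rho_le hLc hM₁ le_rfl)
  have hχ₂ := AP_chi hKc hKconn hKdisj hnt hL hLc hLne hn₂ G₂ q₂ hq₂ hG₂ (AP_of_rho_le hLc hM₂ le_rfl)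
  refine ⟨⟨?_, hlt₁⟩, le_antisymm ?_ ?_⟩
  · refine lt_of_le_of_ne hn₁ fun h0 => ?_
    rw [← h0] at hχ₁
    exact not_AP_zero hKc hm hKconn hKdisj hnt hL hLc (hχ₁ 0)
  · exact rho_le_of_AP hn₂ hlt₂ (AP_of_chi hKdisj hL hLc hn₂ G₁ q₁ hG₁ hχ₂)
  · exact rho_le_of_AP hn₁ hlt₁ (AP_of_chi hKdisj hL hLc hn₁ G₂ q₂ hG₂ hχ₁)
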